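/- Let 1 ≤ β < ∞ be a real number and let 𝒫 be a class of stably finite unital C*-algebras each of which has β-comparison. Then every simple unital C*-algebra A that is asymptotically tracially in 𝒫 has β-comparison. -/

import Mathlib

open Filter Topology Matrix

/-- Cuntz subequivalence for matrices over a topological *-ring. -/
def MatCuntzLE {R : Type} [NonUnitalRing R] [StarRing R] [TopologicalSpace R]
    {ι κ : Type} [Fintype ι] [Fintype κ] (a : Matrix ι ι R) (b : Matrix κ κ R) : Prop :=
  ∃ v : ℕ → Matrix ι κ R,
    Filter.Tendsto (fun k => v k * b * (v k)ᴴ) Filter.atTop (nhds a)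

/-- Positivity of a matrix over a C*-algebra: `a = cᴴ * c` for some `c`. -/
def MatPos {R : Type} [NonUnitalRing R] [StarRing R] {ι : Type} [Fintype ι]
    (a : Matrix ι ι R) : Prop :=
  ∃ c : Matrix ι ι R, a = cᴴ * c

/-- The `k`-fold direct sum `a ⊕ ⋯ ⊕ a`, representing `k⟨a⟩` in the Cuntz semigroup. -/
def matRep {R : Type} [NonUnitalRing R] {ι : Type} (k : ℕ) (a : Matrix ι ι R) :
    Matrix (ι × Fin k) (ι × Fin k) R :=
  Matrix.blockDiagonal fun _ : Fin k => a

/-- `β`-comparison in the sense of Kirchberg–Rørdam. -/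
def BetaComparison (R : Type) [NonUnitalRing R] [StarRing R] [TopologicalSpace R] (β : ℝ) : Prop :=
  ∀ (n m k l : ℕ), 1 ≤ k → 1 ≤ l → β * (l : ℝ) < (k : ℝ) →
    ∀ (a : Matrix (Fin n) (Fin n) R) (b : Matrix (Fin m) (Fin m) R),
      MatPos a → MatPos b → MatCuntzLE (matRep k a) (matRep l b) → MatCuntzLE a b

/-- `n`-comparison in the sense of Winter. -/
def NComparison (R : Type) [NonUnitalRing R] [StarRing R] [TopologicalSpace R] (N : ℕ) : Prop :=
  ∀ (na : ℕ) (mb : Fin (N + 1) → ℕ)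
    (a : Matrix (Fin na) (Fin na) R) (b : ∀ j, Matrix (Fin (mb j)) (Fin (mb j)) R),
    MatPos a → (∀ j, MatPos (b j)) →
    (∀ j, ∃ k : ℕ, 1 ≤ k ∧ MatCuntzLE (matRep (k + 1) a) (matRep k (b j))) →
    MatCuntzLE a (Matrix.blockDiagonal' b)

/-- Almost unperforation of the Cuntz semigroup `W(R)`. -/
def AlmostUnperforatedW (R : Type) [NonUnitalRing R] [StarRing R] [TopologicalSpace R] : Prop :=
  ∀ (n m : ℕ) (a : Matrix (Fin n) (Fin n) R) (b : Matrix (Fin m) (Fin m) R),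
    MatPos a → MatPos b →
    ∀ k : ℕ, 1 ≤ k → MatCuntzLE (matRep (k + 1) a) (matRep k b) → MatCuntzLE a b

/-- Stable finiteness: every isometry in every matrix algebra is a unitary. -/
def StablyFinite (R : Type) [Ring R] [StarRing R] : Prop :=
  ∀ (n : ℕ) (v : Matrix (Fin n) (Fin n) R), vᴴ * v = 1 → v * vᴴ = 1



/-- Cuntz subequivalence for elements of a C*-algebra. -/
def CuntzLE {A : Type} [Mul A] [Star A] [TopologicalSpace A] (a b : A) : Prop :=
  ∃ v : ℕ → A, Filter.Tendsto (fun k => v k * b * star (v k)) Filter.atTop (nhds a)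

/-- A completely positive contractive linear map between C*-algebras. -/
def IsCPC {A B : Type} [NonUnitalCStarAlgebra A] [NonUnitalCStarAlgebra B]
    [NormedSpace ℂ A] [NormedSpace ℂ B] [StarModule ℂ A] [StarModule ℂ B]
    (φ : A →ₗ[ℂ] B) : Prop :=
  (∀ x, ‖φ x‖ ≤ ‖x‖) ∧
    ∀ (n : ℕ) (a : Matrix (Fin n) (Fin n) A), MatPos a → MatPos (a.map φ)

/-- A bundled unital C*-algebra. -/
structure BundledCStarAlgebra : Type 1 where
  carrier : Type
  [str : CStarAlgebra carrier]

attribute [instance] BundledCStarAlgebra.str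

/-- A unital C*-algebra is (topologically) simple if its only closed two-sided ideals
are trivial. -/
def IsSimpleCStarAlgebra (A : Type) [CStarAlgebra A] : Prop :=
  ∀ I : TwoSidedIdeal A, IsClosed (I : Set A) → I = ⊥ ∨ I = ⊤


/-- Definition (Fu–Lin): `A` is asymptotically tracially in the class `P`. -/
def AsympTraciallyIn (P : BundledCStarAlgebra → Prop) (A : Type) [CStarAlgebra A] : Prop :=
  ∀ (ε : ℝ), 0 < ε → ∀ (F : Finset A) (c : A), (∃ d : A, c = star d * d) → c ≠ 0 →
    ∃ B : BundledCStarAlgebra, P B ∧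
      ∃ (α : A →ₗ[ℂ] B.carrier) (βn : ℕ → (B.carrier →ₗ[ℂ] A)) (γn : ℕ → (A →ₗ[ℂ] A)),
        IsCPC α ∧ (∀ n, IsCPC (βn n)) ∧ (∀ n, IsCPC (γn n)) ∧
        -- each `γn` maps into `A ∩ βn(B)^⊥`
        (∀ (n : ℕ) (x : A) (b : B.carrier),
          γn n x * βn n b = 0 ∧ βn n b * γn n x = 0) ∧
        -- (1)
        α 1 = 1 ∧
        (∀ n : ℕ, IsIdempotentElem (βn n 1) ∧ IsSelfAdjoint (βn n 1) ∧
          IsIdempotentElem (γn n 1) ∧ IsSelfAdjoint (γn n 1) ∧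
          βn n 1 + γn n 1 = 1) ∧
        -- (2)
        (∀ x ∈ F, ∀ n : ℕ, ‖x - γn n x - βn n (α x)‖ < ε) ∧
        -- (3) `α` is an `F`-`ε` approximate embedding
        (∀ x ∈ F, ∀ y ∈ F, ‖α x * α y - α (x * y)‖ < ε) ∧
        (∀ x ∈ F, ‖x‖ - ε ≤ ‖α x‖) ∧
        -- (4)
        (∀ x y : B.carrier,
          Filter.Tendsto (fun n => ‖βn n (x * y) - βn n x * βn n y‖) Filter.atTop (nhds 0) ∧
          Filter.Tendsto (fun n => ‖βn n x‖) Filter.atTop (nhds ‖x‖)) ∧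
        -- (5)
        (∀ n : ℕ, CuntzLE (γn n 1) c)



namespace BC
section abstractC
variable {D : Type*} [CStarAlgebra D]

def P (x : D) : Prop := ∃ c : D, x = star c * c

attribute [local instance] CStarAlgebra.spectralOrder CStarAlgebra.spectralOrderedRing

lemma P_iff (x : D) : P x ↔ 0 ≤ x := by
  constructor
  · rintro ⟨c, rfl⟩; exact star_mul_self_nonneg c
  · intro h
    obtain ⟨c, hc⟩ := CStarAlgebra.nonneg_iff_eq_star_mul_self.mp h
    exact ⟨c, hc⟩

lemma csmul_one (r : ℝ) : ((r : ℂ) • (1 : D)) = algebraMap ℝ D r := by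
  rw [Algebra.algebraMap_eq_smul_one, Complex.coe_smul]

lemma ab1 {x y : D} (hx : P x) (hy : P y) : P (x + y) := by
  rw [P_iff] at *; exact add_nonneg hx hy

lemma ab2 {x : D} (hx : star x = x) {r : ℝ} (h : ‖x‖ ≤ r) : P ((r : ℂ) • 1 - x) := by
  rw [P_iff, sub_nonneg, csmul_one]
  have hx' : IsSelfAdjoint x := hx
  exact hx'.le_algebraMap_norm_self.trans (algebraMap_mono D h)

lemma ab3 {x : D} (hx : star x = x) : ∃ p q : D, P p ∧ P q ∧ x = p - q ∧ p * q = 0 ∧ q * p = 0 := by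
  have hx' : IsSelfAdjoint x := hx
  refine ⟨x⁺, x⁻, ?_, ?_, ?_, ?_, ?_⟩
  · rw [P_iff]; exact CFC.posPart_nonneg x
  · rw [P_iff]; exact CFC.negPart_nonneg x
  · exact (CFC.posPart_sub_negPart x).symm
  · exact CFC.posPart_mul_negPart x
  · exact CFC.negPart_mul_posPart x

lemma ab4 {x : D} (hx : P x) : ∃ s : D, P s ∧ x = s * s := by
  rw [P_iff] at hx
  refine ⟨CFC.sqrt x, ?_, (CFC.sqrt_mul_sqrt_self x hx).symm⟩
  rw [P_iff]; exact CFC.sqrt_nonneg x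

lemma P.sa {x : D} (hx : P x) : star x = x := by
  obtain ⟨c, rfl⟩ := hx; simp

lemma ab5 {a c : D} (ha : P a) (hc : P c) {ε : ℝ} (hε : 0 < ε) (h : P (c + (ε : ℂ) • 1 - a)) :
    ∃ u : D, ‖a * a - u * c * star u‖ ≤ ε * ‖a‖ := by
  obtain ⟨s, hs, rfl⟩ := ab4 ha
  have hss : star s = s := hs.sa
  rw [P_iff] at *
  rw [sub_nonneg] at h
  set b : D := c + (ε : ℂ) • 1 with hb
  have hbε : algebraMap ℝ D ε ≤ b := by rw [hb, csmul_one]; exact le_add_of_nonneg_left hc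
  have hεp : IsStrictlyPositive (algebraMap ℝ D ε) := by
    refine ⟨(algebraMap_nonneg D hε.le), ?_⟩
    exact (IsUnit.mk0 ε hε.ne').map (algebraMap ℝ D)
  have hbp : IsStrictlyPositive b := hεp.of_le hbε
  have hb0 : 0 ≤ b := hbp.nonneg
  have hbu : IsUnit b := hbp.isUnit
  set q : D := b ^ (-(1/2) : ℝ) with hq
  have hq0 : 0 ≤ q := CFC.rpow_nonneg
  have hqs : star q = q := (IsSelfAdjoint.of_nonneg hq0)
  have hqbq : q * b * q = 1 := CFC.conjugate_rpow_neg_one_half b hbp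
  -- commuting: q q b = 1
  have hqq : q * q * b = 1 := by
    have hcomm : b * q = q * b := by
      have : b = b ^ (1:ℝ) := (CFC.rpow_one b hb0).symm
      conv_lhs => rw [this, hq, ← CFC.rpow_add hbu]
      conv_rhs => rw [this, hq]
      rw [CFC.rpow_one b hb0, add_comm, CFC.rpow_add hbu, CFC.rpow_one b hb0]
    rw [mul_assoc, ← hcomm, ← mul_assoc, hqbq]
  refine ⟨s * s * q, ?_⟩
  have hqcomm : q * b = b * q := by
    have h1 : q * (q * b) = 1 := by rw [← mul_assoc]; exact hqq
    have h2 : (q * b) * q = 1 := hqbq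
    have h3 : (b * q) * q = 1 := by
      have := congrArg star hqq
      simpa [hqs, (IsSelfAdjoint.of_nonneg hb0).star_eq, mul_assoc] using this
    calc q * b = (q * b) * (q * (q * b)) := by rw [h1, mul_one]
      _ = (q * b * q) * (q * b) := by noncomm_ring
      _ = (b * q * q) * (q * b) := by rw [h2, h3]
      _ = b * q * (q * (q * b)) := by noncomm_ring
      _ = b * q := by rw [h1, mul_one]
  have hcb : c = b - (ε : ℂ) • 1 := by rw [hb]; abel
  have key : s * s * (s * s) - s * s * q * c * star (s * s * q) =
      (ε : ℂ) • (s * (s * q * star (s * q)) * s) := by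
    rw [hcb]
    simp only [star_mul, hss, hqs]
    have e1 : s * s * q * (b - (ε : ℂ) • 1) * (q * (s * s)) =
        s * s * (q * b * q) * (s * s) - (ε : ℂ) • (s * s * q * (q * (s * s))) := by
      simp only [mul_sub, sub_mul, mul_smul_comm, smul_mul_assoc, mul_one, mul_assoc]
    rw [e1, hqbq]
    simp only [mul_one, mul_assoc, sub_sub_cancel]
  rw [key]
  have hn : ‖s * q‖ ≤ 1 := by
    have h1 : star (s * q) * (s * q) ≤ 1 := by
      simp only [star_mul, hss, hqs]
      have := star_left_conjugate_le_conjugate h q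
      rw [hqs, hqbq] at this
      simpa [mul_assoc] using this
    have h2 : ‖star (s * q) * (s * q)‖ ≤ 1 :=
      (CStarAlgebra.norm_le_one_iff_of_nonneg _ (star_mul_self_nonneg _)).2 h1
    rw [CStarRing.norm_star_mul_self] at h2
    nlinarith [norm_nonneg (s * q)]
  have hsn : ‖s * s‖ = ‖s‖ * ‖s‖ := by
    have := CStarRing.norm_star_mul_self (x := s)
    rwa [hss] at this
  rw [norm_smul, hsn]
  have : ‖s * (s * q * star (s * q)) * s‖ ≤ ‖s‖ * (‖s * q‖ * ‖star (s*q)‖) * ‖s‖ := by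
    refine (norm_mul_le _ _).trans ?_
    gcongr
    refine (norm_mul_le _ _).trans ?_
    gcongr
    exact norm_mul_le _ _
  rw [norm_star] at this
  have h4 : ‖s * q‖ * ‖s * q‖ ≤ 1 := by nlinarith [norm_nonneg (s * q)]
  have : ‖s * (s * q * star (s * q)) * s‖ ≤ ‖s‖ * ‖s‖ := by
    refine this.trans ?_
    have := mul_le_mul_of_nonneg_left h4 (mul_nonneg (norm_nonneg s) (norm_nonneg s))
    nlinarith
  have hε' : ‖(ε : ℂ)‖ = ε := by simp [abs_of_pos hε]
  rw [hε']
  gcongr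

lemma ab6 {a : D} (ha : P a) {ε : ℝ} (hε : 0 < ε) : ∃ u : D, ‖a - u * (a * a) * star u‖ ≤ ε := by
  rw [P_iff] at ha
  have hsp : ∀ x ∈ spectrum ℝ a, 0 ≤ x := fun x hx => spectrum_nonneg_of_nonneg ha hx
  have hsa : IsSelfAdjoint a := IsSelfAdjoint.of_nonneg ha
  have hcont : ContinuousOn (fun x : ℝ => (Real.sqrt (x + ε))⁻¹) (spectrum ℝ a) := by
    apply ContinuousOn.inv₀
    · fun_prop
    · intro x hx
      have := hsp x hx
      positivity
  refine ⟨cfc (fun x : ℝ => (Real.sqrt (x + ε))⁻¹) a, ?_⟩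
  have hs : star (cfc (fun x : ℝ => (Real.sqrt (x + ε))⁻¹) a) =
      cfc (fun x : ℝ => (Real.sqrt (x + ε))⁻¹) a := (cfc_predicate _ a : IsSelfAdjoint _)
  rw [hs]
  have hid : a = cfc (fun x : ℝ => x) a := (cfc_id' ℝ a).symm
  have : a - cfc (fun x : ℝ => (Real.sqrt (x + ε))⁻¹) a * (a * a) *
      cfc (fun x : ℝ => (Real.sqrt (x + ε))⁻¹) a =
      cfc (fun x : ℝ => x - (Real.sqrt (x + ε))⁻¹ * (x * x) * (Real.sqrt (x + ε))⁻¹) a := by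
    rw [cfc_sub _ _ a (by fun_prop) (by fun_prop), cfc_mul _ _ a (by fun_prop) (by fun_prop),
      cfc_mul _ _ a (by fun_prop) (by fun_prop), cfc_mul _ _ a (by fun_prop) (by fun_prop), ← hid]
  rw [this]
  apply norm_cfc_le hε.le
  intro x hx
  have h0 := hsp x hx
  have h1 : (Real.sqrt (x + ε))⁻¹ * (x * x) * (Real.sqrt (x + ε))⁻¹ = x * x / (x + ε) := by
    have : (Real.sqrt (x + ε))⁻¹ * (Real.sqrt (x + ε))⁻¹ = (x + ε)⁻¹ := by
      rw [← mul_inv, Real.mul_self_sqrt (by positivity)]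
    rw [mul_right_comm, this]; field_simp
  rw [h1]
  have h2 : x - x * x / (x + ε) = x * ε / (x + ε) := by field_simp; ring
  rw [h2, Real.norm_of_nonneg (by positivity), div_le_iff₀ (by positivity)]
  nlinarith

lemma ab56 {a : D} (ha : P a) {τ : ℝ} (hτ : 0 < τ) : ∃ ε : ℝ, 0 < ε ∧ ∀ c : D, P c →
    P (c + (ε : ℂ) • 1 - a) → ∃ u : D, ‖a - u * c * star u‖ ≤ τ := by
  obtain ⟨w, hw⟩ := ab6 ha (half_pos hτ)
  refine ⟨τ / (2 * (‖w‖ * ‖w‖ * ‖a‖ + 1)), by positivity, fun c hc h => ?_⟩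
  obtain ⟨u, hu⟩ := ab5 ha hc (by positivity) h
  refine ⟨w * u, ?_⟩
  have e : a - w * u * c * star (w * u) = (a - w * (a * a) * star w) +
      w * (a * a - u * c * star u) * star w := by
    rw [star_mul]; noncomm_ring
  rw [e]
  refine (norm_add_le _ _).trans ?_
  have : ‖w * (a * a - u * c * star u) * star w‖ ≤ ‖w‖ * (τ / (2 * (‖w‖ * ‖w‖ * ‖a‖ + 1)) * ‖a‖) * ‖w‖ := by
    refine (norm_mul_le _ _).trans ?_
    rw [norm_star]
    gcongr
    refine (norm_mul_le _ _).trans ?_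
    gcongr
  have h2 : ‖w‖ * (τ / (2 * (‖w‖ * ‖w‖ * ‖a‖ + 1)) * ‖a‖) * ‖w‖ ≤ τ / 2 := by
    have : ‖w‖ * (τ / (2 * (‖w‖ * ‖w‖ * ‖a‖ + 1)) * ‖a‖) * ‖w‖ =
      (τ / 2) * ((‖w‖ * ‖w‖ * ‖a‖) / (‖w‖ * ‖w‖ * ‖a‖ + 1)) := by field_simp
    rw [this]
    have : (‖w‖ * ‖w‖ * ‖a‖) / (‖w‖ * ‖w‖ * ‖a‖ + 1) ≤ 1 := by
      rw [div_le_one (by positivity)]; linarith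
    nlinarith
  linarith

lemma ab7 {y : D} (hy : P y) (hy0 : y ≠ 0) : ∃ r z e : D, star r = r ∧ y * r = r * y ∧
    e = y * z * y ∧ P e ∧ e ≠ 0 ∧ r * y * r * e = e := by
  rw [P_iff] at hy
  have hn : Nontrivial D := ⟨y, 0, hy0⟩
  have hny : 0 < ‖y‖ := norm_pos_iff.2 hy0
  set δ := ‖y‖ / 2 with hδ
  have hδ0 : 0 < δ := by positivity
  have hsp : ∀ x ∈ spectrum ℝ y, 0 ≤ x := fun x hx => spectrum_nonneg_of_nonneg hy hx
  have hsa : IsSelfAdjoint y := IsSelfAdjoint.of_nonneg hy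
  have hcont : ContinuousOn (fun x : ℝ => (Real.sqrt (max x δ))⁻¹) (spectrum ℝ y) := by
    apply ContinuousOn.inv₀
    · fun_prop
    · intro x hx
      have : 0 < max x δ := lt_max_of_lt_right hδ0
      positivity
  have hid : cfc (fun x : ℝ => x) y = y := (cfc_id' ℝ y)
  have hE : y * cfc (fun x : ℝ => max (x - δ) 0) y * y = cfc (fun x : ℝ => x * max (x - δ) 0 * x) y := by
    rw [cfc_mul _ _ y (by fun_prop) (by fun_prop), cfc_mul _ _ y (by fun_prop) (by fun_prop), hid]
  refine ⟨cfc (fun x : ℝ => (Real.sqrt (max x δ))⁻¹) y, cfc (fun x : ℝ => max (x - δ) 0) y, _,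
    (cfc_predicate _ y : IsSelfAdjoint _), ?_, rfl, ?_, ?_, ?_⟩
  · have h1 := cfc_mul (fun x : ℝ => x) (fun x : ℝ => (Real.sqrt (max x δ))⁻¹) y (by fun_prop) hcont
    have h2 := cfc_mul (fun x : ℝ => (Real.sqrt (max x δ))⁻¹) (fun x : ℝ => x) y hcont (by fun_prop)
    rw [hid] at h1 h2
    rw [← h1, ← h2]; simp only [mul_comm]
  · rw [P_iff, hE]
    apply cfc_nonneg
    intro x hx
    have := hsp x hx
    positivity
  · rw [hE]
    intro h0
    have hm : ‖y‖ ∈ spectrum ℝ y := CStarAlgebra.norm_mem_spectrum_of_nonneg hy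
    have hm2 : ‖y‖ * max (‖y‖ - δ) 0 * ‖y‖ ∈ spectrum ℝ (cfc (fun x : ℝ => x * max (x - δ) 0 * x) y) := by
      rw [cfc_map_spectrum (fun x : ℝ => x * max (x - δ) 0 * x) y]
      exact ⟨_, hm, rfl⟩
    rw [h0, spectrum.zero_eq] at hm2
    have h3 : ‖y‖ - δ = δ := by rw [hδ]; ring
    rw [h3, max_eq_left hδ0.le] at hm2
    have : ‖y‖ * δ * ‖y‖ ≠ 0 := by positivity
    exact this hm2
  · rw [hE]
    have : cfc (fun x : ℝ => (Real.sqrt (max x δ))⁻¹) y * y * cfc (fun x : ℝ => (Real.sqrt (max x δ))⁻¹) y *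
       cfc (fun x : ℝ => x * max (x - δ) 0 * x) y =
       cfc (fun x : ℝ => (Real.sqrt (max x δ))⁻¹ * x * (Real.sqrt (max x δ))⁻¹ * (x * max (x - δ) 0 * x)) y := by
      have c1 := cfc_mul (fun x : ℝ => (Real.sqrt (max x δ))⁻¹) (fun x : ℝ => x) y
        (by fun_prop) (by fun_prop)
      have c2 := cfc_mul (fun x : ℝ => (Real.sqrt (max x δ))⁻¹ * x)
        (fun x : ℝ => (Real.sqrt (max x δ))⁻¹) y (by fun_prop) (by fun_prop)
      have c3 := cfc_mul (fun x : ℝ => (Real.sqrt (max x δ))⁻¹ * x * (Real.sqrt (max x δ))⁻¹)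
        (fun x : ℝ => x * max (x - δ) 0 * x) y (by fun_prop) (by fun_prop)
      rw [c3, c2, c1, hid]
    rw [this]
    apply cfc_congr
    intro x hx
    have hx0 := hsp x hx
    have hm : 0 < max x δ := lt_max_of_lt_right hδ0
    have h1 : (Real.sqrt (max x δ))⁻¹ * x * (Real.sqrt (max x δ))⁻¹ = x / max x δ := by
      have : (Real.sqrt (max x δ))⁻¹ * (Real.sqrt (max x δ))⁻¹ = (max x δ)⁻¹ := by
        rw [← mul_inv, Real.mul_self_sqrt hm.le]
      rw [mul_right_comm, this]; field_simp
    simp only [h1]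
    rcases le_total x δ with h | h
    · rw [max_eq_right (sub_nonpos.2 h)]; simp
    · rw [max_eq_left h] 
      rcases hx0.eq_or_lt with h' | h'
      · rw [← h'] at h; linarith
      · rw [div_self h'.ne', one_mul]

lemma ab8 {x : D} (h : P x) (h' : P (-x)) : x = 0 := by
  rw [P_iff] at *
  exact le_antisymm (by simpa using h') h

lemma ab9 {x h : D} (hh : P h) {C : ℝ} (hC1 : P ((C : ℂ) • h - x)) (hC2 : P (x + (C : ℂ) • h))
    (H : ∀ t : ℝ, P (x - (t : ℂ) • h) ∨ P ((t : ℂ) • h - x)) : ∃ t : ℝ, x = (t : ℂ) • h := by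
  by_cases h0 : h = 0
  · subst h0
    refine ⟨0, ?_⟩
    simp only [smul_zero, zero_sub, add_zero] at *
    exact ab8 hC2 hC1
  simp only [P_iff, Complex.coe_smul] at *
  set S : Set ℝ := {t | 0 ≤ x - t • h} with hS
  have hcl : IsClosed S := by
    have : Continuous (fun t : ℝ => x - t • h) := by fun_prop
    exact (CStarAlgebra.isClosed_nonneg (A := D)).preimage this
  have hcl2 : IsClosed {t : ℝ | 0 ≤ t • h - x} := by
    have : Continuous (fun t : ℝ => t • h - x) := by fun_prop
    exact (CStarAlgebra.isClosed_nonneg (A := D)).preimage this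
  have hne : S.Nonempty := ⟨-C, by rw [hS, Set.mem_ofPred_eq, neg_smul, sub_neg_eq_add]; exact hC2⟩
  have hbd : BddAbove S := by
    refine ⟨C, fun t ht => ?_⟩
    by_contra hlt
    push Not at hlt
    have h1 : 0 ≤ (x - t • h) + (C • h - x) := add_nonneg ht hC1
    have h2 : 0 ≤ -((t - C) • h) := by
      convert h1 using 1
      rw [sub_smul]; abel
    have h3 : 0 ≤ (t - C) • h := smul_nonneg (by linarith) hh
    have h4 : (t - C) • h = 0 := le_antisymm (by simpa using h2) h3
    rcases smul_eq_zero.1 h4 with h5 | h5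
    · linarith
    · exact h0 h5
  refine ⟨sSup S, ?_⟩
  have m1 : sSup S ∈ S := hcl.csSup_mem hne hbd
  have m2 : sSup S ∈ {t : ℝ | 0 ≤ t • h - x} := by
    rw [← hcl2.closure_eq]
    have : sSup S ∈ closure (Set.Ioi (sSup S)) := by
      rw [closure_Ioi]; exact Set.self_mem_Ici
    refine closure_mono ?_ this
    intro t ht
    rcases H t with h1 | h1
    · exact absurd (le_csSup hbd h1) (not_le.2 ht)
    · exact h1
  exact le_antisymm (by simpa using m2) (by simpa [hS] using m1)

end abstractC
end BC


namespace BC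
section mat
variable {A : Type} [CStarAlgebra A] {ι κ μ : Type} [Fintype ι] [Fintype κ] [Fintype μ]
  [DecidableEq ι] [DecidableEq κ] [DecidableEq μ]

section transfer
attribute [local instance] CStarAlgebra.spectralOrder CStarAlgebra.spectralOrderedRing

lemma mat_add {x y : Matrix ι ι A} (hx : MatPos x) (hy : MatPos y) : MatPos (x + y) :=
  ab1 (D := CStarMatrix ι ι A) hx hy

lemma mat_pn {x : Matrix ι ι A} (hx : xᴴ = x) : ∃ p q : Matrix ι ι A, MatPos p ∧ MatPos q ∧
    x = p - q ∧ p * q = 0 ∧ q * p = 0 := ab3 (D := CStarMatrix ι ι A) hx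

lemma mat_sqrt {x : Matrix ι ι A} (hx : MatPos x) : ∃ s : Matrix ι ι A, MatPos s ∧ x = s * s :=
  ab4 (D := CStarMatrix ι ι A) hx

lemma mat_cut {y : Matrix ι ι A} (hy : MatPos y) (hy0 : y ≠ 0) :
    ∃ r z e : Matrix ι ι A, rᴴ = r ∧ y * r = r * y ∧
    e = y * z * y ∧ MatPos e ∧ e ≠ 0 ∧ r * y * r * e = e :=
  ab7 (D := CStarMatrix ι ι A) hy hy0

lemma mat_antisymm {x : Matrix ι ι A} (h : MatPos x) (h' : MatPos (-x)) : x = 0 :=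
  ab8 (D := CStarMatrix ι ι A) h h'

lemma mat_scalar {x h : Matrix ι ι A} (hh : MatPos h) {C : ℝ} (hC1 : MatPos ((C : ℂ) • h - x))
    (hC2 : MatPos (x + (C : ℂ) • h))
    (H : ∀ t : ℝ, MatPos (x - (t : ℂ) • h) ∨ MatPos ((t : ℂ) • h - x)) :
    ∃ t : ℝ, x = (t : ℂ) • h :=
  ab9 (D := CStarMatrix ι ι A) hh hC1 hC2 H

open WithCStarModule CStarMatrix in
lemma cnorm_le (M : CStarMatrix ι κ A) : ‖M‖ ≤ ∑ j, ∑ i, ‖M i j‖ := by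
  rw [CStarMatrix.norm_def]
  refine (toCLM M).opNorm_le_bound (by positivity) fun v => ?_
  simp only [toCLM_apply_eq_sum, Finset.sum_mul]
  apply pi_norm_le_sum_norm _ |>.trans
  gcongr with i _
  apply norm_sum_le _ _ |>.trans
  gcongr with j _
  apply norm_mul_le _ _ |>.trans
  rw [mul_comm]
  gcongr
  exact norm_apply_le_norm v j

lemma mat_le_of_sum {x : Matrix ι ι A} (hx : xᴴ = x) {r : ℝ} (h : ∑ j, ∑ i, ‖x i j‖ ≤ r) :
    MatPos ((r : ℂ) • 1 - x) :=
  ab2 (D := CStarMatrix ι ι A) (x := x) hx ((cnorm_le (A := A) (ι := ι) (κ := ι) x).trans h)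

lemma mat_crit_aux {a : Matrix ι ι A} (ha : MatPos a) {τ : ℝ} (hτ : 0 < τ) :
    ∃ ε : ℝ, 0 < ε ∧ ∀ c : Matrix ι ι A, MatPos c →
    MatPos (c + (ε : ℂ) • 1 - a) → ∃ u : Matrix ι ι A, ∀ i j, ‖(a - u * c * uᴴ) i j‖ ≤ τ := by
  obtain ⟨ε, hε, h⟩ := ab56 (D := CStarMatrix ι ι A) (a := a) ha hτ
  refine ⟨ε, hε, fun c hc h' => ?_⟩
  obtain ⟨u, hu⟩ := h c hc h'
  exact ⟨u, fun i j => (CStarMatrix.norm_entry_le_norm (A := A)).trans hu⟩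

end transfer

lemma _root_.MatPos.herm {x : Matrix ι ι A} (hx : MatPos x) : xᴴ = x := by
  obtain ⟨c, rfl⟩ := hx; simp

lemma mat_zero : MatPos (0 : Matrix ι ι A) := ⟨0, by simp⟩

lemma mat_one : MatPos (1 : Matrix ι ι A) := ⟨1, by simp⟩

lemma _root_.MatPos.smul {x : Matrix ι ι A} (hx : MatPos x) {r : ℝ} (hr : 0 ≤ r) :
    MatPos ((r : ℂ) • x) := by
  obtain ⟨c, rfl⟩ := hx
  refine ⟨((Real.sqrt r : ℝ) : ℂ) • c, ?_⟩
  rw [Matrix.conjTranspose_smul, smul_mul_smul_comm]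
  congr 1
  simp only [RCLike.star_def, Complex.conj_ofReal]
  rw [← Complex.ofReal_mul, Real.mul_self_sqrt hr]

lemma mat_sum {J : Type} (s : Finset J) {f : J → Matrix ι ι A} (h : ∀ j ∈ s, MatPos (f j)) :
    MatPos (∑ j ∈ s, f j) := by
  classical
  induction s using Finset.induction_on with
  | empty => simpa using mat_zero
  | insert a s ha ih =>
    rw [Finset.sum_insert ha]
    exact mat_add (h a (by simp)) (ih fun j hj => h j (by simp [hj]))

lemma mat_gram (v : Matrix κ ι A) : MatPos (vᴴ * v) := by
  rcases isEmpty_or_nonempty ι with h | ⟨⟨i0⟩⟩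
  · exact ⟨0, by ext i; exact h.elim i⟩
  · have : vᴴ * v = ∑ k, (Matrix.of fun i j => if i = i0 then v k j else 0)ᴴ *
      (Matrix.of fun i j => if i = i0 then v k j else 0) := by
      ext i j
      simp only [Matrix.mul_apply, Matrix.sum_apply, Matrix.conjTranspose_apply, Matrix.of_apply]
      refine Finset.sum_congr rfl fun k _ => ?_
      rw [Finset.sum_eq_single i0] <;> simp +contextual
    rw [this]
    exact mat_sum _ fun k _ => ⟨_, rfl⟩

lemma mat_gram' (v : Matrix ι κ A) : MatPos (v * vᴴ) := by
  simpa using mat_gram vᴴ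

lemma _root_.MatPos.conj {b : Matrix κ κ A} (hb : MatPos b) (v : Matrix ι κ A) :
    MatPos (v * b * vᴴ) := by
  obtain ⟨c, rfl⟩ := hb
  have := mat_gram (c * vᴴ)
  simpa [Matrix.mul_assoc] using this

/-- Order on matrices. -/
def MLE (a b : Matrix ι ι A) : Prop := MatPos (b - a)

lemma MLE.rfl' (a : Matrix ι ι A) : MLE a a := by
  unfold MLE; rw [sub_self]; exact mat_zero

lemma mle_of_eq {a b : Matrix ι ι A} (h : a = b) : MLE a b := h ▸ MLE.rfl' a

lemma MLE.trans {a b c : Matrix ι ι A} (h : MLE a b) (h' : MLE b c) : MLE a c := by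
  have := mat_add h h'
  unfold MLE; convert this using 1; abel

lemma MLE.add {a b c d : Matrix ι ι A} (h : MLE a b) (h' : MLE c d) : MLE (a + c) (b + d) := by
  have := mat_add h h'
  unfold MLE; convert this using 1; abel

lemma MLE.conj {a b : Matrix κ κ A} (h : MLE a b) (v : Matrix ι κ A) :
    MLE (v * a * vᴴ) (v * b * vᴴ) := by
  have := MatPos.conj h v
  unfold MLE; convert this using 1
  rw [Matrix.mul_sub, Matrix.sub_mul]

lemma MLE.smul {a b : Matrix ι ι A} (h : MLE a b) {r : ℝ} (hr : 0 ≤ r) :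
    MLE ((r : ℂ) • a) ((r : ℂ) • b) := by
  have := MatPos.smul h hr
  unfold MLE; convert this using 1
  rw [smul_sub]

lemma _root_.MatPos.le_add {a b : Matrix ι ι A} (h : MatPos b) : MLE a (a + b) := by
  unfold MLE; simpa using h

lemma mle_bound {x : Matrix ι ι A} (hx : xᴴ = x) : ∃ C : ℝ, 0 ≤ C ∧ MLE x ((C : ℂ) • 1) :=
  ⟨∑ j, ∑ i, ‖x i j‖, by positivity, mat_le_of_sum hx le_rfl⟩

lemma mle_smul_one {r s : ℝ} (h : r ≤ s) : MLE ((r : ℂ) • (1 : Matrix ι ι A)) ((s : ℂ) • 1) := by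
  unfold MLE
  rw [← sub_smul, ← Complex.ofReal_sub]
  exact mat_one.smul (by linarith)

lemma mle_of_close {x y : Matrix ι ι A} (hx : xᴴ = x) (hy : yᴴ = y) {r : ℝ}
    (h : ∑ j, ∑ i, ‖(x - y) i j‖ ≤ r) : MLE x (y + (r : ℂ) • 1) := by
  have := mat_le_of_sum (x := x - y) (by simp [hx, hy]) h
  unfold MLE; convert this using 1; abel

/-- Order formulation of Cuntz subequivalence. -/
def CLE (a : Matrix ι ι A) (b : Matrix κ κ A) : Prop :=
  ∀ ε : ℝ, 0 < ε → ∃ v : Matrix ι κ A, MLE a (v * b * vᴴ + (ε : ℂ) • 1)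

lemma CLE.toMat {a : Matrix ι ι A} {b : Matrix κ κ A} (ha : MatPos a) (hb : MatPos b)
    (h : CLE a b) : MatCuntzLE a b := by
  have key : ∀ n : ℕ, ∃ v : Matrix ι κ A, ∀ i j, ‖(a - v * b * vᴴ) i j‖ ≤ 1 / ((n : ℝ) + 1) := by
    intro n
    obtain ⟨ε, hε, H⟩ := mat_crit_aux ha (τ := 1 / ((n : ℝ) + 1)) (by positivity)
    obtain ⟨v, hv⟩ := h ε hε
    obtain ⟨u, hu⟩ := H (v * b * vᴴ) (hb.conj v) hv
    refine ⟨u * v, ?_⟩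
    simpa [Matrix.mul_assoc] using hu
  choose v hv using key
  refine ⟨v, ?_⟩
  refine tendsto_pi_nhds.2 fun i => tendsto_pi_nhds.2 fun j => ?_
  rw [tendsto_iff_norm_sub_tendsto_zero]
  refine squeeze_zero (fun _ => norm_nonneg _) (fun n => ?_) tendsto_one_div_add_atTop_nhds_zero_nat
  rw [norm_sub_rev]
  exact hv n i j

lemma CLE.ofMat {a : Matrix ι ι A} {b : Matrix κ κ A} (ha : MatPos a) (hb : MatPos b)
    (h : MatCuntzLE a b) : CLE a b := by
  intro ε hε
  obtain ⟨v, hv⟩ := h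
  have h1 : Tendsto (fun n => ∑ j, ∑ i, ‖(a - v n * b * (v n)ᴴ) i j‖) atTop (𝓝 0) := by
    have : (0 : ℝ) = ∑ j : ι, ∑ i : ι, 0 := by simp
    rw [this]
    refine tendsto_finsetSum _ fun j _ => tendsto_finsetSum _ fun i _ => ?_
    have h2 := (tendsto_pi_nhds.1 ((tendsto_pi_nhds.1 hv) i)) j
    rw [tendsto_iff_norm_sub_tendsto_zero] at h2
    simpa [norm_sub_rev] using h2
  obtain ⟨n, hn⟩ := (h1.eventually (gt_mem_nhds hε)).exists
  exact ⟨v n, mle_of_close ha.herm (hb.conj (v n)).herm hn.le⟩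

lemma cle_conj (b : Matrix κ κ A) (v : Matrix ι κ A) : CLE (v * b * vᴴ) b := fun ε hε =>
  ⟨v, (mat_one.smul hε.le).le_add⟩

lemma cle_of_mle {a b : Matrix ι ι A} (h : MLE a b) : CLE a b := fun ε hε =>
  ⟨1, by simpa using h.trans (mat_one.smul hε.le).le_add⟩

lemma CLE.refl (a : Matrix ι ι A) : CLE a a := cle_of_mle (MLE.rfl' a)

lemma CLE.trans {a : Matrix ι ι A} {b : Matrix κ κ A} {c : Matrix μ μ A} (h : CLE a b)
    (h' : CLE b c) : CLE a c := by
  intro ε hε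
  obtain ⟨v, hv⟩ := h (ε / 2) (half_pos hε)
  obtain ⟨C, hC, hvC⟩ := mle_bound (mat_gram' v).herm
  obtain ⟨w, hw⟩ := h' (ε / (2 * (C + 1))) (by positivity)
  refine ⟨v * w, hv.trans ?_⟩
  have h1 := (hw.conj v).add (MLE.rfl' (((ε / 2 : ℝ) : ℂ) • (1 : Matrix ι ι A)))
  refine h1.trans ?_
  have h2 : v * (w * c * wᴴ + ((ε / (2 * (C + 1)) : ℝ) : ℂ) • 1) * vᴴ =
      (v * w) * c * (v * w)ᴴ + ((ε / (2 * (C + 1)) : ℝ) : ℂ) • (v * vᴴ) := by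
    simp [Matrix.mul_add, Matrix.add_mul, Matrix.mul_assoc]
  rw [h2, add_assoc]
  refine (MLE.rfl' _).add ?_
  have h3 := (hvC.smul (r := ε / (2 * (C + 1))) (by positivity)).add
    (MLE.rfl' (((ε / 2 : ℝ) : ℂ) • (1 : Matrix ι ι A)))
  refine h3.trans ?_
  rw [smul_smul, ← add_smul, ← Complex.ofReal_mul, ← Complex.ofReal_add]
  apply mle_smul_one
  have : ε / (2 * (C + 1)) * C = (ε / 2) * (C / (C + 1)) := by field_simp
  rw [this]
  have : C / (C + 1) ≤ 1 := by rw [div_le_one (by positivity)]; linarith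
  nlinarith

lemma cle_smul (a : Matrix ι ι A) {r : ℝ} (hr : 0 ≤ r) : CLE ((r : ℂ) • a) a := by
  have := cle_conj a (((Real.sqrt r : ℝ) : ℂ) • (1 : Matrix ι ι A))
  convert this using 1
  rw [Matrix.conjTranspose_smul, Matrix.conjTranspose_one, Matrix.smul_mul, Matrix.one_mul,
    Matrix.smul_mul, Matrix.mul_smul, Matrix.mul_one, smul_smul, RCLike.star_def, Complex.conj_ofReal,
    ← Complex.ofReal_mul, Real.mul_self_sqrt hr]

lemma cle_of_mle_smul {a b : Matrix ι ι A} {r : ℝ} (hr : 0 ≤ r) (h : MLE a ((r : ℂ) • b)) :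
    CLE a b := (cle_of_mle h).trans (cle_smul b hr)

/-- `x ≤ x²/(4ε) + ε`. -/
lemma mle_sq {x : Matrix ι ι A} (hx : xᴴ = x) {ε : ℝ} (hε : 0 < ε) :
    MLE x (((1 / (4 * ε) : ℝ) : ℂ) • (x * x) + (ε : ℂ) • 1) := by
  have h := (mat_gram (((1 / (2 * ε) : ℝ) : ℂ) • x - 1)).smul hε.le
  unfold MLE
  convert h using 1
  simp only [Matrix.conjTranspose_sub, Matrix.conjTranspose_smul, hx, Matrix.conjTranspose_one,
    RCLike.star_def, Complex.conj_ofReal, Matrix.mul_sub, Matrix.sub_mul, Matrix.smul_mul,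
    Matrix.mul_smul, Matrix.one_mul, Matrix.mul_one, smul_sub, smul_smul, ← Complex.ofReal_mul]
  have e1 : ε * (1 / (2 * ε) * (1 / (2 * ε))) = 1 / (4 * ε) := by field_simp; norm_num
  have e2 : ε * (1 / (2 * ε)) = 1 / 2 := by field_simp
  rw [e1, e2]
  have e3 : x = ((1 / 2 : ℝ) : ℂ) • x + ((1 / 2 : ℝ) : ℂ) • x := by
    rw [← add_smul, ← Complex.ofReal_add]; norm_num
  conv_lhs => rw [e3]
  conv_lhs => 
    enter [1,1,2]
    rw [← e3]
  abel

lemma cle_sq {x : Matrix ι ι A} (hx : xᴴ = x) : CLE x (x * x) := by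
  intro ε hε
  refine ⟨((Real.sqrt (1 / (4 * ε)) : ℝ) : ℂ) • 1, ?_⟩
  convert mle_sq hx hε using 2
  rw [Matrix.conjTranspose_smul, Matrix.conjTranspose_one, Matrix.smul_mul, Matrix.one_mul,
    Matrix.smul_mul, Matrix.mul_smul, Matrix.mul_one, smul_smul, RCLike.star_def, Complex.conj_ofReal,
    ← Complex.ofReal_mul, Real.mul_self_sqrt (by positivity)]

lemma cle_sq_cube {x : Matrix ι ι A} (hx : MatPos x) : CLE (x * x) (x * x * x) := by
  obtain ⟨s, hs, rfl⟩ := mat_sqrt hx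
  obtain ⟨C, hC, hb⟩ := mle_bound hx.herm
  intro ε hε
  have hd : 0 < ε / (C + 1) := by positivity
  refine ⟨((Real.sqrt (1 / (4 * (ε / (C + 1)))) : ℝ) : ℂ) • 1, ?_⟩
  have h := (mle_sq hx.herm hd).conj s
  rw [hs.herm] at h
  refine (mle_of_eq ?_).trans (h.trans (b := _) ?_)
  · noncomm_ring
  rw [Matrix.conjTranspose_smul, Matrix.conjTranspose_one, Matrix.smul_mul, Matrix.one_mul,
    Matrix.smul_mul, Matrix.mul_smul, Matrix.mul_one, smul_smul, RCLike.star_def, Complex.conj_ofReal,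
    ← Complex.ofReal_mul, Real.mul_self_sqrt (by positivity)]
  rw [Matrix.mul_add, Matrix.add_mul]
  apply MLE.add
  · apply mle_of_eq
    rw [Matrix.mul_smul, Matrix.smul_mul]; congr 1; noncomm_ring
  · rw [Matrix.mul_smul, Matrix.mul_one, Matrix.smul_mul]
    refine (hb.smul hd.le).trans ?_
    rw [smul_smul, ← Complex.ofReal_mul]
    apply mle_smul_one
    rw [div_mul_eq_mul_div, div_le_iff₀ (by positivity)]
    nlinarith

lemma cle_cube {x : Matrix ι ι A} (hx : MatPos x) : CLE x (x * x * x) :=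
  (cle_sq hx.herm).trans (cle_sq_cube hx)

/-- `x*x ≲ x x*` (rectangular). -/
lemma cle_gram_swap (x : Matrix κ ι A) : CLE (xᴴ * x) (x * xᴴ) := by
  refine (cle_sq (mat_gram x).herm).trans ?_
  have := cle_conj (x * xᴴ) xᴴ
  simpa [Matrix.mul_assoc] using this

lemma sub_eq (Y : Matrix κ κ A) (f : ι → κ) :
    Y.submatrix f f = ((1 : Matrix κ κ A).submatrix f id) * Y * ((1 : Matrix κ κ A).submatrix f id)ᴴ := by
  have h1 : ((1 : Matrix κ κ A).submatrix f id) * Y = Y.submatrix f id := by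
    ext i j
    simp [Matrix.mul_apply, Matrix.one_apply]
  rw [h1]
  ext i j
  simp [Matrix.mul_apply, Matrix.one_apply, apply_ite star]

lemma cle_sub (Y : Matrix κ κ A) (f : ι → κ) : CLE (Y.submatrix f f) Y := by
  rw [sub_eq]; exact cle_conj _ _

lemma _root_.MatPos.sub {Y : Matrix κ κ A} (h : MatPos Y) (f : ι → κ) :
    MatPos (Y.submatrix f f) := by
  rw [sub_eq]; exact h.conj _

end mat
end BC


namespace BC
section sums
variable {A : Type} [CStarAlgebra A] {ι κ μ ν : Type} [Fintype ι] [Fintype κ] [Fintype μ] [Fintype ν]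
  [DecidableEq ι] [DecidableEq κ] [DecidableEq μ] [DecidableEq ν]
  {I J K : Type} [Fintype I] [Fintype J] [Fintype K] [DecidableEq I] [DecidableEq J] [DecidableEq K]

/-- repeated direct sum over an index type -/
def rep (J : Type) [DecidableEq J] (a : Matrix ι κ A) : Matrix (ι × J) (κ × J) A :=
  Matrix.blockDiagonal fun _ : J => a

/-- direct sum -/
def dsum (a : Matrix ι κ A) (b : Matrix μ ν A) : Matrix (ι ⊕ μ) (κ ⊕ ν) A := Matrix.fromBlocks a 0 0 b

lemma matRep_eq (k : ℕ) (a : Matrix ι ι A) : matRep k a = rep (Fin k) a := rfl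

lemma rep_apply (a : Matrix ι κ A) (p : ι × J) (q : κ × J) :
    rep J a p q = if p.2 = q.2 then a p.1 q.1 else 0 := by
  simp [rep, Matrix.blockDiagonal_apply]

lemma rep_mul (a : Matrix ι κ A) (b : Matrix κ μ A) : rep J (a * b) = rep J a * rep J b := by
  simp [rep, Matrix.blockDiagonal_mul]

lemma rep_star (a : Matrix ι κ A) : rep J aᴴ = (rep J a)ᴴ := by
  simp [rep, Matrix.blockDiagonal_conjTranspose]

lemma rep_add (a b : Matrix ι κ A) : rep J (a + b) = rep J a + rep J b := by
  ext p q; simp only [rep_apply, Matrix.add_apply]; split_ifs <;> simp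

lemma rep_sub (a b : Matrix ι κ A) : rep J (a - b) = rep J a - rep J b := by
  ext p q; simp only [rep_apply, Matrix.sub_apply]; split_ifs <;> simp

lemma rep_smul (c : ℂ) (a : Matrix ι κ A) : rep J (c • a) = c • rep J a := by
  ext p q; simp only [rep_apply, Matrix.smul_apply]; split_ifs <;> simp

lemma rep_one : rep J (1 : Matrix ι ι A) = 1 := by
  ext ⟨i, j⟩ ⟨i', j'⟩; simp only [rep_apply, Matrix.one_apply, Prod.mk.injEq]
  by_cases h : j = j' <;> by_cases h' : i = i' <;> simp [h, h']

lemma rep_pos {a : Matrix ι ι A} (h : MatPos a) : MatPos (rep J a) := by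
  obtain ⟨c, rfl⟩ := h
  exact ⟨rep J c, by rw [rep_mul, rep_star]⟩

lemma rep_mle {a b : Matrix ι ι A} (h : MLE a b) : MLE (rep J a) (rep J b) := by
  unfold MLE; rw [← rep_sub]; exact rep_pos h

lemma rep_mono {a : Matrix ι ι A} {b : Matrix κ κ A} (h : CLE a b) : CLE (rep J a) (rep J b) := by
  intro ε hε
  obtain ⟨v, hv⟩ := h ε hε
  refine ⟨rep J v, ?_⟩
  have := rep_mle (J := J) hv
  rwa [rep_add, rep_mul, rep_mul, rep_star, rep_smul, rep_one] at this

lemma dsum_mul {ι' κ' : Type} [Fintype ι'] [Fintype κ'] [DecidableEq ι'] [DecidableEq κ']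
    (a : Matrix ι κ A) (b : Matrix μ ν A) (c : Matrix κ ι' A) (d : Matrix ν κ' A) :
    dsum (a * c) (b * d) = dsum a b * dsum c d := by
  simp [dsum, Matrix.fromBlocks_multiply]

lemma dsum_star (a : Matrix ι κ A) (b : Matrix μ ν A) : dsum aᴴ bᴴ = (dsum a b)ᴴ := by
  simp [dsum, Matrix.fromBlocks_conjTranspose]

lemma dsum_pos {a : Matrix ι ι A} {b : Matrix κ κ A} (ha : MatPos a) (hb : MatPos b) :
    MatPos (dsum a b) := by
  obtain ⟨c, rfl⟩ := ha
  obtain ⟨d, rfl⟩ := hb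
  exact ⟨dsum c d, by rw [dsum_mul, dsum_star]⟩

lemma dsum_mono {a : Matrix ι ι A} {b : Matrix κ κ A} {c : Matrix μ μ A} {d : Matrix ν ν A}
    (h : CLE a c) (h' : CLE b d) : CLE (dsum a b) (dsum c d) := by
  intro ε hε
  obtain ⟨v, hv⟩ := h ε hε
  obtain ⟨w, hw⟩ := h' ε hε
  refine ⟨dsum v w, ?_⟩
  have := dsum_pos hv hw
  unfold MLE
  convert this using 1
  rw [← dsum_star, ← dsum_mul, ← dsum_mul]
  simp [dsum, ← Matrix.fromBlocks_one, Matrix.fromBlocks_smul, Matrix.fromBlocks_add,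
    sub_eq_add_neg, Matrix.fromBlocks_neg]

lemma cle_add_dsum (X Y : Matrix ι ι A) : CLE (X + Y) (dsum X Y) := by
  have := cle_conj (dsum X Y) (Matrix.fromCols (1 : Matrix ι ι A) (1 : Matrix ι ι A))
  convert this using 1
  rw [Matrix.conjTranspose_fromCols_eq_fromRows_conjTranspose, dsum, Matrix.fromCols_mul_fromBlocks,
    Matrix.fromCols_mul_fromRows]
  simp

lemma dsum_cle_add {X Y : Matrix ι ι A} (hX : MatPos X) (hY : MatPos Y) (h : X * Y = 0) :
    CLE (dsum X Y) (X + Y) := by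
  have h' : Y * X = 0 := by
    have := congrArg Matrix.conjTranspose h
    simpa [hX.herm, hY.herm] using this
  refine (dsum_mono (cle_cube hX) (cle_cube hY)).trans ?_
  have := cle_conj (X + Y) (Matrix.fromRows X Y)
  convert this using 1
  rw [Matrix.conjTranspose_fromRows_eq_fromCols_conjTranspose, Matrix.fromRows_mul,
    Matrix.fromRows_mul_fromCols, hX.herm, hY.herm, dsum]
  simp [Matrix.mul_add, Matrix.mul_assoc, h, h']

lemma rep_rep_le (e : K ≃ I × J) (a : Matrix ι ι A) : CLE (rep K a) (rep J (rep I a)) := by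
  have := cle_sub (rep J (rep I a)) (fun p : ι × K => ((p.1, (e p.2).1), (e p.2).2))
  convert this using 1
  ext ⟨i, k⟩ ⟨i', k'⟩
  simp only [rep_apply, Matrix.submatrix_apply]
  have he : k = k' ↔ (e k).1 = (e k').1 ∧ (e k).2 = (e k').2 := by
    rw [← e.injective.eq_iff, Prod.ext_iff]
  simp only [he]
  by_cases h1 : (e k).1 = (e k').1 <;> by_cases h2 : (e k).2 = (e k').2 <;> simp [h1, h2]

lemma rep_rep_ge (e : K ≃ I × J) (a : Matrix ι ι A) : CLE (rep J (rep I a)) (rep K a) := by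
  have := cle_sub (rep K a) (fun q : (ι × I) × J => (q.1.1, e.symm (q.1.2, q.2)))
  convert this using 1
  ext ⟨⟨i, k⟩, j⟩ ⟨⟨i', k'⟩, j'⟩
  simp only [rep_apply, Matrix.submatrix_apply]
  simp only [e.symm.injective.eq_iff, Prod.ext_iff]
  by_cases h1 : k = k' <;> by_cases h2 : j = j' <;> simp [h1, h2]

lemma rep_comm_cle (a : Matrix ι ι A) : CLE (rep J (rep I a)) (rep I (rep J a)) :=
  (rep_rep_ge (K := I × J) (Equiv.refl _) a).trans (rep_rep_le (Equiv.prodComm _ _) a)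

lemma rep_dsum_cle (a : Matrix ι ι A) (b : Matrix κ κ A) :
    CLE (rep J (dsum a b)) (dsum (rep J a) (rep J b)) := by
  have := cle_sub (dsum (rep J a) (rep J b))
    (fun q : (ι ⊕ κ) × J => Sum.elim (fun i => Sum.inl (i, q.2)) (fun i => Sum.inr (i, q.2)) q.1)
  convert this using 1
  ext ⟨i, k⟩ ⟨i', k'⟩
  rcases i with i | i <;> rcases i' with i' | i' <;>
    simp [rep_apply, dsum]

lemma dsum_rep_cle (M : ℕ) (a : Matrix ι ι A) : CLE (dsum (rep (Fin M) a) a) (rep (Fin (M + 1)) a) := by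
  have := cle_sub (rep (Fin (M + 1)) a)
    (fun q : (ι × Fin M) ⊕ ι => Sum.elim (fun p => (p.1, p.2.castSucc)) (fun i => (i, Fin.last M)) q)
  convert this using 1
  ext i i'
  rcases i with ⟨i, j⟩ | i <;> rcases i' with ⟨i', j'⟩ | i'
  · simp [rep_apply, dsum]
  · simp [rep_apply, dsum, Fin.castSucc_ne_last]
  · simp [rep_apply, dsum, (Fin.castSucc_ne_last _).symm]
  · simp [rep_apply, dsum]

lemma rep_cle_dsum (M : ℕ) (a : Matrix ι ι A) : CLE (rep (Fin (M + 1)) a) (dsum (rep (Fin M) a) a) := by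
  have := cle_sub (dsum (rep (Fin M) a) a)
    (fun q : ι × Fin (M + 1) => if h : q.2.val < M then Sum.inl (q.1, ⟨q.2.val, h⟩) else Sum.inr q.1)
  convert this using 1
  ext ⟨i, j⟩ ⟨i', j'⟩
  simp only [Matrix.submatrix_apply]
  have hj := j.2
  have hj' := j'.2
  by_cases h : j.val < M <;> by_cases h' : j'.val < M
  · simp [h, h', rep_apply, dsum, Fin.ext_iff]
  · have : j ≠ j' := by intro h; subst h; contradiction
    simp [h, h', rep_apply, dsum, this]
  · have : j ≠ j' := by intro h; subst h; contradiction
    simp [h, h', rep_apply, dsum, this]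
  · have : j = j' := by apply Fin.ext; omega
    subst this
    simp [h, rep_apply, dsum]

lemma cle_zero_dsum (a : Matrix ι ι A) : CLE (rep (Fin 0) a) (0 : Matrix κ κ A) := by
  intro ε hε
  refine ⟨0, 0, ?_⟩
  ext i; exact i.2.elim0

end sums
end BC


namespace BC
section cp
variable {A B : Type} [CStarAlgebra A] [CStarAlgebra B] {ι κ : Type} [Fintype ι] [Fintype κ]
  [DecidableEq ι] [DecidableEq κ] {J : Type} [DecidableEq J] [Fintype J]

lemma cp_pos {φ : A →ₗ[ℂ] B} (hφ : IsCPC φ) {a : Matrix ι ι A} (ha : MatPos a) :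
    MatPos (a.map φ) := by
  have e := Fintype.equivFin ι
  have h1 := hφ.2 _ _ (ha.sub e.symm)
  have h2 := h1.sub e
  convert h2 using 1
  ext i j; simp

lemma cp_star {φ : A →ₗ[ℂ] B} (hφ : IsCPC φ) (x : A) : φ (star x) = star (φ x) := by
  have h := hφ.2 2 (!![1, x; 0, 0]ᴴ * !![1, x; 0, 0]) ⟨_, rfl⟩
  have h1 := congrFun (congrFun h.herm 1) 0
  simp [Matrix.mul_apply, Fin.sum_univ_two] at h1
  exact h1.symm

lemma map_sub' (φ : A →ₗ[ℂ] B) (a b : Matrix ι κ A) : (a - b).map φ = a.map φ - b.map φ := by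
  ext; simp
lemma map_add' (φ : A →ₗ[ℂ] B) (a b : Matrix ι κ A) : (a + b).map φ = a.map φ + b.map φ := by
  ext; simp
lemma map_smul' (φ : A →ₗ[ℂ] B) (c : ℂ) (a : Matrix ι κ A) : (c • a).map φ = c • a.map φ := by
  ext; simp
lemma map_one' (φ : A →ₗ[ℂ] B) : (1 : Matrix ι ι A).map φ = Matrix.diagonal fun _ => φ 1 := by
  ext i j; by_cases h : i = j <;> simp [h, Matrix.one_apply, Matrix.diagonal_apply]
lemma map_rep (φ : A →ₗ[ℂ] B) (a : Matrix ι κ A) : (rep J a).map φ = rep J (a.map φ) := by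
  ext i j; by_cases h : i.2 = j.2 <;> simp [h, rep_apply]
lemma map_star {φ : A →ₗ[ℂ] B} (hφ : IsCPC φ) (a : Matrix ι κ A) : aᴴ.map φ = (a.map φ)ᴴ := by
  ext; simp [cp_star hφ]

lemma cp_mle {φ : A →ₗ[ℂ] B} (hφ : IsCPC φ) {a b : Matrix ι ι A} (h : MLE a b) :
    MLE (a.map φ) (b.map φ) := by
  unfold MLE; rw [← map_sub']; exact cp_pos hφ h

lemma approx_mle {φ : A →ₗ[ℂ] B} (hφ : IsCPC φ) (v : Matrix ι κ A) {c : Matrix κ κ A} (hc : cᴴ = c)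
    {δ r : ℝ}
    (h1 : ∀ i p q, ‖φ (v i p) * φ (c p q) - φ (v i p * c p q)‖ ≤ δ)
    (h2 : ∀ i p q j, ‖φ (v i p * c p q) * φ (star (v j q)) - φ (v i p * c p q * star (v j q))‖ ≤ δ)
    (hr : δ * (∑ j : ι, ∑ _i : ι, ∑ q : κ, ∑ _p : κ, (1 + ‖v j q‖)) ≤ r) :
    MLE ((v * c * vᴴ).map φ) (v.map φ * c.map φ * (v.map φ)ᴴ + (r : ℂ) • 1) := by
  apply mle_of_close
  · rw [← map_star hφ]; simp [hc, Matrix.mul_assoc]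
  · simp [← map_star hφ, hc, Matrix.mul_assoc]
  refine le_trans ?_ hr
  rw [Finset.mul_sum]
  refine Finset.sum_le_sum fun j _ => ?_
  rw [Finset.mul_sum]
  refine Finset.sum_le_sum fun i _ => ?_
  have e1 : ((v * c * vᴴ).map φ - v.map φ * c.map φ * (v.map φ)ᴴ) i j =
      ∑ q, ∑ p, (φ (v i p * c p q * star (v j q)) - φ (v i p) * φ (c p q) * φ (star (v j q))) := by
    simp [Matrix.mul_apply, Finset.sum_mul, cp_star hφ]
  rw [e1, Finset.mul_sum]
  refine (norm_sum_le _ _).trans (Finset.sum_le_sum fun q _ => ?_)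
  rw [Finset.mul_sum]
  refine (norm_sum_le _ _).trans (Finset.sum_le_sum fun p _ => ?_)
  have e2 : φ (v i p * c p q * star (v j q)) - φ (v i p) * φ (c p q) * φ (star (v j q)) =
    - (φ (v i p * c p q) * φ (star (v j q)) - φ (v i p * c p q * star (v j q))) -
     (φ (v i p) * φ (c p q) - φ (v i p * c p q)) * φ (star (v j q)) := by
    rw [sub_mul]; abel
  rw [e2]
  refine (norm_sub_le _ _).trans ?_
  rw [norm_neg, mul_add, mul_one]
  refine add_le_add (h2 i p q j) ((norm_mul_le _ _).trans ?_)
  have h3 : ‖φ (star (v j q))‖ ≤ ‖v j q‖ := by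
    refine (hφ.1 _).trans ?_
    rw [norm_star]
  exact mul_le_mul (h1 i p q) h3 (norm_nonneg _) ((norm_nonneg _).trans (h1 i p q))

lemma cp_gram_bound {φ : A →ₗ[ℂ] B} (hφ : IsCPC φ) (v : Matrix ι κ A) {η r : ℝ} (hη : 0 ≤ η)
    (hr : η * (∑ j : ι, ∑ i : ι, ∑ q : κ, ‖v i q‖ * ‖v j q‖) ≤ r) :
    MLE ((η : ℂ) • (v.map φ * (v.map φ)ᴴ)) ((r : ℂ) • 1) := by
  have h1 : MLE (v.map φ * (v.map φ)ᴴ)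
      (((∑ j : ι, ∑ i : ι, ∑ q : κ, ‖v i q‖ * ‖v j q‖ : ℝ) : ℂ) • 1) := by
    apply mat_le_of_sum (mat_gram' _).herm
    refine Finset.sum_le_sum fun j _ => Finset.sum_le_sum fun i _ => ?_
    rw [Matrix.mul_apply]
    refine (norm_sum_le _ _).trans (Finset.sum_le_sum fun q _ => ?_)
    refine (norm_mul_le _ _).trans ?_
    simp only [Matrix.map_apply, Matrix.conjTranspose_apply, norm_star]
    exact mul_le_mul (hφ.1 _) (hφ.1 _) (norm_nonneg _) (norm_nonneg _)
  refine (h1.smul hη).trans ?_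
  rw [smul_smul, ← Complex.ofReal_mul]
  exact mle_smul_one hr
end cp

section stepB
variable {B : Type} [CStarAlgebra B]

lemma add_smul_one {ι : Type} [Fintype ι] [DecidableEq ι] (r s : ℝ) :
    (r : ℂ) • (1 : Matrix ι ι B) + (s : ℂ) • 1 = ((r + s : ℝ) : ℂ) • 1 := by
  rw [← add_smul, Complex.ofReal_add]

lemma stepB {β : ℝ} (hB : BetaComparison B β) {n m k l : ℕ} (hk : 1 ≤ k) (hl : 1 ≤ l)
    (hkl : β * (l : ℝ) < (k : ℝ)) {x : Matrix (Fin n) (Fin n) B} {y : Matrix (Fin m) (Fin m) B}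
    (hx : MatPos x) (hy : MatPos y) (w : Matrix (Fin n × Fin k) (Fin m × Fin l) B)
    {ε η : ℝ} (hε : 0 < ε)
    (h1 : MLE (rep (Fin k) x) (w * rep (Fin l) y * wᴴ + ((2 * ε : ℝ) : ℂ) • 1))
    (h2 : MLE ((η : ℂ) • (w * wᴴ)) ((ε : ℂ) • 1)) :
    ∃ w1 : Matrix (Fin n) (Fin m) B,
      MLE x (w1 * (y - (η : ℂ) • 1) * w1ᴴ + ((4 * ε : ℝ) : ℂ) • 1) := by
  have hs1 : ∀ (r : ℝ) (j : ℕ), ((r : ℂ) • (1 : Matrix (Fin j) (Fin j) B))ᴴ = (r : ℂ) • 1 := by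
    intro r j; simp [Matrix.conjTranspose_smul]
  obtain ⟨z, z', hz, hz', hzz, hzz1, hzz2⟩ := mat_pn (x := y - (η : ℂ) • 1) (by
    rw [Matrix.conjTranspose_sub, hy.herm, hs1])
  obtain ⟨x', x'', hx', hx'', hxx, hxx1, hxx2⟩ := mat_pn (x := x - ((3 * ε : ℝ) : ℂ) • 1) (by
    rw [Matrix.conjTranspose_sub, hx.herm, hs1])
  -- rep x ≤ w rep z w* + 3 ε
  have h3 : MLE (rep (Fin k) x) (w * rep (Fin l) z * wᴴ + ((3 * ε : ℝ) : ℂ) • 1) := by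
    refine h1.trans ?_
    have hyz : MLE y (z + (η : ℂ) • 1) := by
      unfold MLE; convert hz' using 1
      rw [sub_eq_iff_eq_add] at hzz
      rw [hzz]; abel
    have h4 := (rep_mle (J := Fin l) hyz).conj w
    refine (h4.add (MLE.rfl' _)).trans ?_
    rw [rep_add, rep_smul, rep_one, Matrix.mul_add, Matrix.add_mul, add_assoc]
    refine (MLE.rfl' _).add ?_
    rw [Matrix.mul_smul, Matrix.mul_one, Matrix.smul_mul]
    refine (h2.add (MLE.rfl' _)).trans (mle_of_eq ?_)
    rw [add_smul_one]; congr 3; ring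
  have h5 : x' * x' * x' = x' * (x - ((3 * ε : ℝ) : ℂ) • 1) * x' := by
    rw [hxx, Matrix.mul_sub, hxx1, sub_zero]
  have h6 : MLE (rep (Fin k) (x' * x' * x'))
      ((rep (Fin k) x' * w) * rep (Fin l) z * (rep (Fin k) x' * w)ᴴ) := by
    have h7 : MLE (rep (Fin k) (x - ((3 * ε : ℝ) : ℂ) • 1)) (w * rep (Fin l) z * wᴴ) := by
      unfold MLE at h3 ⊢
      convert h3 using 1
      rw [rep_sub, rep_smul, rep_one]; abel
    have h8 := h7.conj (rep (Fin k) x')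
    rw [h5, rep_mul, rep_mul]
    convert h8 using 1
    · rw [← rep_star, hx'.herm]
    · simp only [Matrix.conjTranspose_mul, Matrix.mul_assoc]
  have h9 : CLE (rep (Fin k) x') (rep (Fin l) z) :=
    (rep_mono (cle_cube hx')).trans ((cle_of_mle h6).trans (cle_conj _ _))
  have h10 : CLE x' z := CLE.ofMat hx' hz
    (hB n m k l hk hl hkl x' z hx' hz (CLE.toMat (rep_pos hx') (rep_pos hz) h9))
  obtain ⟨u, hu⟩ := (h10.trans (cle_cube hz)) ε hε
  refine ⟨u * z, ?_⟩
  have h11 : z * z * z = z * (y - (η : ℂ) • 1) * z := by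
    rw [hzz, Matrix.mul_sub, hzz1, sub_zero]
  have h12 : MLE x (x' + ((3 * ε : ℝ) : ℂ) • 1) := by
    unfold MLE; convert hx'' using 1
    rw [sub_eq_iff_eq_add] at hxx
    rw [hxx]; abel
  refine h12.trans ((hu.add (MLE.rfl' _)).trans (mle_of_eq ?_))
  rw [add_assoc, add_smul_one, h11, Matrix.conjTranspose_mul, hz.herm]
  simp only [Matrix.mul_assoc]
  congr 4; ring
end stepB
end BC


namespace BC
section ML
variable {A B : Type} [CStarAlgebra A] [CStarAlgebra B]

lemma exists_delta (K r : ℝ) (hK : 0 ≤ K) (hr : 0 < r) : ∃ δ : ℝ, 0 < δ ∧ ∀ δ', 0 ≤ δ' → δ' ≤ δ → δ' * K ≤ r := by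
  refine ⟨r / (K + 1), by positivity, fun δ' h0 h => ?_⟩
  calc δ' * K ≤ r / (K + 1) * (K + 1) := by
        apply mul_le_mul h (by linarith) hK (by positivity)
    _ = r := by field_simp

lemma diag_cle {n : ℕ} {g e : A} (hg : star g = g) (he : star e = e) (h : CuntzLE g e) :
    CLE (Matrix.diagonal fun _ : Fin n => g) (Matrix.diagonal fun _ : Fin n => e) := by
  intro ε hε
  obtain ⟨v, hv⟩ := h
  have h1 : Tendsto (fun N => (n : ℝ) * ‖g - v N * e * star (v N)‖) atTop (𝓝 0) := by
    rw [tendsto_iff_norm_sub_tendsto_zero] at hv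
    have := hv.const_mul (n : ℝ)
    simpa [norm_sub_rev] using this
  obtain ⟨N, hN⟩ := (h1.eventually (gt_mem_nhds hε)).exists
  refine ⟨Matrix.diagonal fun _ => v N, ?_⟩
  apply mle_of_close
  · simp [Matrix.diagonal_conjTranspose, Pi.star_def, hg]
  · simp [Matrix.diagonal_conjTranspose, Pi.star_def, he, mul_assoc]
  · simp only [Matrix.diagonal_conjTranspose, Pi.star_def, Matrix.diagonal_mul_diagonal,
      Matrix.diagonal_sub]
    refine le_trans (le_of_eq ?_) hN.le
    have : ∀ j i : Fin n, ‖Matrix.diagonal (fun _ : Fin n => g - v N * e * star (v N)) i j‖ =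
      if i = j then ‖g - v N * e * star (v N)‖ else 0 := by
      intro j i; rw [Matrix.diagonal_apply]; split_ifs <;> simp
    simp [this]

/-- Push back from `B` to `A`. -/
lemma stepC {n m : ℕ} {β : B →ₗ[ℂ] A} {γ : A →ₗ[ℂ] A} {α : A →ₗ[ℂ] B}
    (hα : IsCPC α) (hβ : IsCPC β) (hγ : IsCPC γ)
    (ho : ∀ (x : A) (b : B), γ x * β b = 0 ∧ β b * γ x = 0)
    (hp : IsIdempotentElem (β 1)) (hps : IsSelfAdjoint (β 1)) (hsum : β 1 + γ 1 = 1)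
    {a : Matrix (Fin n) (Fin n) A} {b : Matrix (Fin m) (Fin m) A} (ha : MatPos a) (hb : MatPos b)
    {ε η δ C : ℝ} (hε : 0 < ε) (hC : MLE a ((C : ℂ) • 1))
    (hδa : ∀ i j, ‖a i j - γ (a i j) - β (α (a i j))‖ ≤ δ)
    (hδb : ∀ i j, ‖b i j - γ (b i j) - β (α (b i j))‖ ≤ δ)
    (hδ1 : δ * ∑ _j : Fin n, ∑ _i : Fin n, (1 : ℝ) ≤ ε) (hδ2 : δ * ∑ _j : Fin m, ∑ _i : Fin m, (1 : ℝ) ≤ η)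
    (w : Matrix (Fin n) (Fin m) B)
    (hw : MLE (a.map α) (w * (b.map α - (η : ℂ) • 1) * wᴴ + ((4 * ε : ℝ) : ℂ) • 1))
    (happ : MLE ((w * (b.map α - (η : ℂ) • 1) * wᴴ).map β)
      (w.map β * (b.map α - (η : ℂ) • 1).map β * (w.map β)ᴴ + (ε : ℂ) • 1)) :
    ∃ X : Matrix (Fin n) (Fin m) A, MLE a (X * b * Xᴴ + (C : ℂ) • (Matrix.diagonal fun _ => γ 1) +
      ((6 * ε : ℝ) : ℂ) • 1) := by
  -- the projection
  set Pm : Matrix (Fin m) (Fin m) A := Matrix.diagonal fun _ => β 1 with hPm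
  have hPs : Pmᴴ = Pm := by
    rw [hPm, Matrix.diagonal_conjTranspose]; simp [Pi.star_def, hps.star_eq]
  have hPP : Pm * Pm = Pm := by
    rw [hPm, Matrix.diagonal_mul_diagonal]; simp only [hp.eq]
  have hpβ : ∀ x, β 1 * β x = β x := fun x => by
    have : β 1 = 1 - γ 1 := eq_sub_of_add_eq hsum
    rw [this, sub_mul, (ho 1 x).1]; simp
  have hβp : ∀ x, β x * β 1 = β x := fun x => by
    have : β 1 = 1 - γ 1 := eq_sub_of_add_eq hsum
    rw [this, mul_sub, (ho 1 x).2]; simp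
  have hPβ : Pm * (b.map α).map β * Pm = (b.map α).map β := by
    ext i j; simp [hPm, hpβ, hβp]
  have hPγ : Pm * b.map γ * Pm = 0 := by
    ext i j; simp [hPm, (ho _ _).2]
  -- β y ≤ P b P + η P
  have c1 : MLE ((b.map α).map β) (Pm * b * Pm + (η : ℂ) • Pm) := by
    have c2 : MLE ((b.map α).map β) (b - b.map γ + (η : ℂ) • 1) := by
      apply mle_of_close (cp_pos hβ (cp_pos hα hb)).herm
      · rw [Matrix.conjTranspose_sub, hb.herm, (cp_pos hγ hb).herm]
      · refine le_trans ?_ hδ2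
        rw [Finset.mul_sum]
        refine Finset.sum_le_sum fun j _ => ?_
        rw [Finset.mul_sum]
        refine Finset.sum_le_sum fun i _ => ?_
        rw [mul_one, ← norm_neg]
        refine (le_of_eq (congrArg norm ?_)).trans (hδb i j)
        simp only [Matrix.sub_apply, Matrix.map_apply]
        abel
    have c3 := c2.conj Pm
    rw [hPs, hPβ, Matrix.mul_add, Matrix.add_mul, Matrix.mul_sub, Matrix.sub_mul, hPγ, sub_zero,
      Matrix.mul_smul, Matrix.mul_one, Matrix.smul_mul, hPP] at c3
    exact c3
  have hone : MLE ((1 : Matrix (Fin n) (Fin n) B).map β) 1 := by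
    unfold MLE
    have : (1 : Matrix (Fin n) (Fin n) A) - (1 : Matrix (Fin n) (Fin n) B).map β =
      (1 : Matrix (Fin n) (Fin n) A).map γ := by
      rw [map_one', map_one', ← Matrix.diagonal_one, Matrix.diagonal_sub, eq_sub_of_add_eq hsum]
      simp
    rw [this]
    exact cp_pos hγ mat_one
  -- β x ≤ W b W* + 5 ε
  have c4 : MLE ((a.map α).map β) ((w.map β * Pm) * b * (w.map β * Pm)ᴴ + ((5 * ε : ℝ) : ℂ) • 1) := by
    refine (cp_mle hβ hw).trans ?_
    rw [map_add', map_smul']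
    refine (happ.add (hone.smul (by positivity))).trans ?_
    rw [add_assoc, add_smul_one]
    have e5 : ε + 4 * ε = 5 * ε := by ring
    rw [e5]
    refine MLE.add ?_ (MLE.rfl' _)
    have c5 : MLE ((b.map α - (η : ℂ) • 1).map β) (Pm * b * Pm) := by
      unfold MLE at c1 ⊢
      convert c1 using 1
      rw [map_sub', map_smul', map_one', ← hPm]; abel
    refine (c5.conj _).trans (mle_of_eq ?_)
    simp [Matrix.mul_assoc, hPs]
  have c6 : MLE a ((a.map α).map β + a.map γ + (ε : ℂ) • 1) := by
    apply mle_of_close ha.herm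
    · rw [Matrix.conjTranspose_add, (cp_pos hγ ha).herm, (cp_pos hβ (cp_pos hα ha)).herm]
    · refine le_trans ?_ hδ1
      rw [Finset.mul_sum]
      refine Finset.sum_le_sum fun j _ => ?_
      rw [Finset.mul_sum]
      refine Finset.sum_le_sum fun i _ => ?_
      rw [mul_one]
      refine (le_of_eq (congrArg norm ?_)).trans (hδa i j)
      simp only [Matrix.sub_apply, Matrix.add_apply, Matrix.map_apply]
      abel
  have c7 : MLE (a.map γ) ((C : ℂ) • (Matrix.diagonal fun _ => γ 1)) := by
    have := cp_mle hγ hC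
    rwa [map_smul', map_one'] at this
  refine ⟨w.map β * Pm, c6.trans ?_⟩
  refine ((c4.add c7).add (MLE.rfl' _)).trans (mle_of_eq ?_)
  have e6 : ((6 * ε : ℝ) : ℂ) • (1 : Matrix (Fin n) (Fin n) A) = ((5 * ε : ℝ) : ℂ) • 1 + (ε : ℂ) • 1 := by
    rw [add_smul_one]; congr 2; ring
  rw [e6]; abel

lemma main_lemma {P : BundledCStarAlgebra → Prop} {β : ℝ}
    (hP : ∀ B : BundledCStarAlgebra, P B → BetaComparison B.carrier β)
    (hA : AsympTraciallyIn P A) {n m k l : ℕ} (hk : 1 ≤ k) (hl : 1 ≤ l)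
    (hkl : β * (l : ℝ) < (k : ℝ)) {a : Matrix (Fin n) (Fin n) A} {b : Matrix (Fin m) (Fin m) A}
    (ha : MatPos a) (hb : MatPos b) (h : CLE (rep (Fin k) a) (rep (Fin l) b))
    {e : A} (he : ∃ d, e = star d * d) (he0 : e ≠ 0) :
    CLE a (dsum b (Matrix.diagonal fun _ : Fin n => e)) := by
  classical
  intro ε0 hε0
  obtain ⟨ε, hε, rfl⟩ : ∃ ε : ℝ, 0 < ε ∧ ε0 = 7 * ε := ⟨ε0 / 7, by positivity, by ring⟩
  obtain ⟨v, hv⟩ := h ε hε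
  obtain ⟨C, hC0, hC⟩ := mle_bound ha.herm
  set c := rep (Fin l) b with hc
  have hcs : cᴴ = c := (rep_pos hb).herm
  obtain ⟨η, hη, hη'⟩ := exists_delta (∑ j, ∑ i, ∑ q, ‖v i q‖ * ‖v j q‖) ε (by positivity) hε
  obtain ⟨δ1, hδ1, hδ1'⟩ := exists_delta
    (∑ j : Fin n × Fin k, ∑ _i : Fin n × Fin k, ∑ q : Fin m × Fin l, ∑ _p : Fin m × Fin l, (1 + ‖v j q‖))
    ε (by positivity) hε
  obtain ⟨δ2, hδ2, hδ2'⟩ := exists_delta (∑ _j : Fin n, ∑ _i : Fin n, (1 : ℝ)) ε (by positivity) hε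
  obtain ⟨δ3, hδ3, hδ3'⟩ := exists_delta (∑ _j : Fin m, ∑ _i : Fin m, (1 : ℝ)) η (by positivity) hη
  set δ := min δ1 (min δ2 δ3) with hδ
  have hδ0 : 0 < δ := by positivity
  have i1 : δ ≤ δ1 := min_le_left _ _
  have i2 : δ ≤ δ2 := (min_le_right _ _).trans (min_le_left _ _)
  have i3 : δ ≤ δ3 := (min_le_right _ _).trans (min_le_right _ _)
  have hfin : Set.Finite ((Set.range fun p : Fin n × Fin n => a p.1 p.2) ∪
      (Set.range fun p : Fin m × Fin m => b p.1 p.2) ∪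
      (Set.range fun p : (Fin n × Fin k) × (Fin m × Fin l) => v p.1 p.2) ∪
      (Set.range fun p : (Fin n × Fin k) × (Fin m × Fin l) => star (v p.1 p.2)) ∪
      (Set.range fun p : (Fin m × Fin l) × (Fin m × Fin l) => c p.1 p.2) ∪
      (Set.range fun p : (Fin n × Fin k) × (Fin m × Fin l) × (Fin m × Fin l) =>
        v p.1 p.2.1 * c p.2.1 p.2.2)) :=
    (((((Set.finite_range _).union (Set.finite_range _)).union (Set.finite_range _)).union
      (Set.finite_range _)).union (Set.finite_range _)).union (Set.finite_range _)
  obtain ⟨B, hPB, α, βn, γn, hα, hβn, hγn, ho, hα1, h1, h2, h3, -, h4, h5⟩ :=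
    hA δ hδ0 hfin.toFinset e he he0
  have Fa : ∀ i j, a i j ∈ hfin.toFinset := fun i j => by
    rw [Set.Finite.mem_toFinset]; exact Or.inl (Or.inl (Or.inl (Or.inl (Or.inl ⟨(i, j), rfl⟩))))
  have Fb : ∀ i j, b i j ∈ hfin.toFinset := fun i j => by
    rw [Set.Finite.mem_toFinset]; exact Or.inl (Or.inl (Or.inl (Or.inl (Or.inr ⟨(i, j), rfl⟩))))
  have Fv : ∀ i j, v i j ∈ hfin.toFinset := fun i j => by
    rw [Set.Finite.mem_toFinset]; exact Or.inl (Or.inl (Or.inl (Or.inr ⟨(i, j), rfl⟩)))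
  have Fs : ∀ i j, star (v i j) ∈ hfin.toFinset := fun i j => by
    rw [Set.Finite.mem_toFinset]; exact Or.inl (Or.inl (Or.inr ⟨(i, j), rfl⟩))
  have Fc : ∀ i j, c i j ∈ hfin.toFinset := fun i j => by
    rw [Set.Finite.mem_toFinset]; exact Or.inl (Or.inr ⟨(i, j), rfl⟩)
  have Fvc : ∀ i j q, v i j * c j q ∈ hfin.toFinset := fun i j q => by
    rw [Set.Finite.mem_toFinset]; exact Or.inr ⟨(i, j, q), rfl⟩
  -- step A
  have s1 := approx_mle hα v hcs (δ := δ) (fun i p q => (h3 _ (Fv i p) _ (Fc p q)).le)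
    (fun i p q j => (h3 _ (Fvc i p q) _ (Fs j q)).le) (hδ1' δ hδ0.le i1)
  have s2 : MLE (rep (Fin k) (a.map α)) (v.map α * rep (Fin l) (b.map α) * (v.map α)ᴴ +
      ((2 * ε : ℝ) : ℂ) • 1) := by
    have s3 := cp_mle hα hv
    rw [map_rep, map_add', map_smul', map_one', hα1, Matrix.diagonal_one] at s3
    refine s3.trans ((s1.add (MLE.rfl' _)).trans (mle_of_eq ?_))
    rw [add_assoc, add_smul_one, hc, map_rep]
    congr 3; ring
  have s4 := cp_gram_bound hα v hη.le (hη' η hη.le le_rfl)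
  obtain ⟨w, hw⟩ := stepB (hP B hPB) hk hl hkl (cp_pos hα ha) (cp_pos hα hb) (v.map α) hε s2 s4
  -- step C
  set y := b.map α - (η : ℂ) • (1 : Matrix (Fin m) (Fin m) B.carrier) with hy
  have hys : yᴴ = y := by
    rw [hy, Matrix.conjTranspose_sub, (cp_pos hα hb).herm]; simp [Matrix.conjTranspose_smul]
  obtain ⟨δ', hδ', hδ''⟩ := exists_delta
    (∑ j : Fin n, ∑ _i : Fin n, ∑ q : Fin m, ∑ _p : Fin m, (1 + ‖w j q‖)) ε (by positivity) hε
  have hmul : ∀ x z : B.carrier, ∀ᶠ N in atTop, ‖βn N x * βn N z - βn N (x * z)‖ ≤ δ' := by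
    intro x z
    filter_upwards [(h4 x z).1.eventually (gt_mem_nhds hδ')] with N hN
    rw [norm_sub_rev]; exact hN.le
  have ev1 : ∀ᶠ N in atTop, ∀ i p q, ‖βn N (w i p) * βn N (y p q) - βn N (w i p * y p q)‖ ≤ δ' := by
    simp only [eventually_all]
    intro i p q; exact hmul _ _
  have ev2 : ∀ᶠ N in atTop, ∀ i p q j, ‖βn N (w i p * y p q) * βn N (star (w j q)) -
      βn N (w i p * y p q * star (w j q))‖ ≤ δ' := by
    simp only [eventually_all]
    intro i p q j; exact hmul _ _
  obtain ⟨N, hN1, hN2⟩ := (ev1.and ev2).exists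
  obtain ⟨q1, q2, q3, q4, q5⟩ := h1 N
  have s5 := approx_mle (hβn N) w hys hN1 hN2 (hδ'' δ' hδ'.le le_rfl)
  obtain ⟨X, hX⟩ := stepC hα (hβn N) (hγn N) (ho N) q1 q2 q5 ha hb hε hC
    (fun i j => (h2 _ (Fa i j) N).le) (fun i j => (h2 _ (Fb i j) N).le)
    (hδ2' δ hδ0.le i2) (hδ3' δ hδ0.le i3) w hw s5
  have hes : star e = e := by obtain ⟨d, rfl⟩ := he; simp
  obtain ⟨U, hU⟩ := ((cle_smul _ hC0).trans (diag_cle (n := n) q4.star_eq hes (h5 N))) ε hε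
  refine ⟨Matrix.fromCols X U, hX.trans ?_⟩
  refine (((MLE.rfl' _).add hU).add (MLE.rfl' _)).trans (mle_of_eq ?_)
  rw [Matrix.conjTranspose_fromCols_eq_fromRows_conjTranspose, dsum, Matrix.fromCols_mul_fromBlocks,
    Matrix.fromCols_mul_fromRows]
  have e7 : ((7 * ε : ℝ) : ℂ) • (1 : Matrix (Fin n) (Fin n) A) = ((6 * ε : ℝ) : ℂ) • 1 + (ε : ℂ) • 1 := by
    rw [add_smul_one]; congr 2; ring
  rw [e7]
  simp only [Matrix.mul_zero, add_zero, zero_add]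
  abel
end ML
end BC


namespace BC
section prime
variable {A : Type} [CStarAlgebra A]

lemma prime_elem (hs : IsSimpleCStarAlgebra A) {u w : A} (hu : u ≠ 0) (hw : w ≠ 0) :
    ∃ c, u * c * w ≠ 0 := by
  by_contra hcon
  push Not at hcon
  let I : TwoSidedIdeal A := TwoSidedIdeal.mk' {x | ∀ c, u * c * x = 0}
    (by intro c; simp) (by intro x y hx hy c; rw [mul_add, hx c, hy c, add_zero])
    (by intro x hx c; rw [mul_neg, hx c, neg_zero])
    (by intro x y hy c; rw [← mul_assoc, mul_assoc u c x]; exact hy _)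
    (by intro x y hx c; rw [← mul_assoc, hx c, zero_mul])
  have hI : ∀ x, x ∈ I ↔ ∀ c, u * c * x = 0 := by
    intro x
    exact TwoSidedIdeal.mem_mk' _ _ _ _ _ _ x
  have hcl : IsClosed (I : Set A) := by
    have : (I : Set A) = ⋂ c, {x | u * c * x = 0} := by
      ext x; simp only [SetLike.mem_coe, hI, Set.mem_iInter, Set.mem_setOf_eq]
    rw [this]
    exact isClosed_iInter fun c => isClosed_eq (by fun_prop) continuous_const
  rcases hs I hcl with h | h
  · have : w ∈ I := (hI w).2 hcon
    rw [h] at this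
    exact hw (by simpa using this)
  · have : (1 : A) ∈ I := by rw [h]; trivial
    have := (hI 1).1 this 1
    simp at this
    exact hu this

variable {ι κ μ ν : Type} [Fintype ι] [Fintype κ] [Fintype μ] [Fintype ν]
  [DecidableEq ι] [DecidableEq κ] [DecidableEq μ] [DecidableEq ν]

lemma prime_mat (hs : IsSimpleCStarAlgebra A) {f : Matrix ι κ A} {g : Matrix μ ν A} (hf : f ≠ 0)
    (hg : g ≠ 0) : ∃ x : Matrix κ μ A, f * x * g ≠ 0 := by
  obtain ⟨i, j, hij⟩ : ∃ i j, f i j ≠ 0 := by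
    by_contra h; push Not at h; exact hf (by ext i j; exact h i j)
  obtain ⟨i', j', hij'⟩ : ∃ i j, g i j ≠ 0 := by
    by_contra h; push Not at h; exact hg (by ext i j; exact h i j)
  obtain ⟨c, hc⟩ := prime_elem hs hij hij'
  refine ⟨Matrix.single j i' c, fun h => hc ?_⟩
  have := congrFun (congrFun h i) j'
  simpa [Matrix.mul_apply, Matrix.single_apply, Finset.sum_ite_eq, ite_and] using this

section ord
attribute [local instance] CStarAlgebra.spectralOrder CStarAlgebra.spectralOrderedRing

lemma gram_col_zero (c : Matrix κ ι A) (i : ι) (h : (cᴴ * c) i i = 0) (k : κ) : c k i = 0 := by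
  rw [Matrix.mul_apply] at h
  have h1 := (Finset.sum_eq_zero_iff_of_nonneg (fun k _ => by
    simp only [Matrix.conjTranspose_apply]; exact star_mul_self_nonneg (c k i))).1 h k (Finset.mem_univ k)
  simpa using h1
end ord

lemma gram_zero {c : Matrix κ ι A} (h : cᴴ * c = 0) : c = 0 := by
  ext k i; exact gram_col_zero c i (by rw [h]; rfl) k

lemma gram_zero' {c : Matrix ι κ A} (h : c * cᴴ = 0) : c = 0 := by
  have := gram_zero (c := cᴴ) (by simpa using h)
  simpa using this

lemma pos_diag {f : Matrix ι ι A} (hf : MatPos f) (h0 : f ≠ 0) : ∃ i, f i i ≠ 0 := by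
  obtain ⟨c, rfl⟩ := hf
  by_contra h; push Not at h
  apply h0
  have : c = 0 := by ext k i; exact gram_col_zero c i (h i) k
  simp [this]

lemma pos_diag_elem {f : Matrix ι ι A} (hf : MatPos f) (i : ι) : ∃ d, f i i = star d * d := by
  obtain ⟨c, hc⟩ := hf.sub (fun _ : Unit => i)
  refine ⟨c () (), ?_⟩
  have := congrFun (congrFun hc ()) ()
  simpa [Matrix.mul_apply] using this

lemma sTs_le {s T : Matrix ι ι A} (hs : sᴴ = s) (h : (s * T * s)ᴴ = s * T * s) :
    ∃ C : ℝ, 0 ≤ C ∧ MLE (s * T * s) ((C : ℂ) • (s * s)) := by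
  obtain ⟨C, hC, hle⟩ := mle_bound (x := ((1 / 2 : ℝ) : ℂ) • (T + Tᴴ)) (by
    simp [Matrix.conjTranspose_smul, add_comm])
  refine ⟨C, hC, ?_⟩
  have h1 := hle.conj s
  convert h1 using 1
  · have h2 : s * Tᴴ * s = s * T * s := by
      simpa [hs, Matrix.mul_assoc] using h
    rw [hs, Matrix.mul_smul, Matrix.smul_mul, Matrix.mul_add, Matrix.add_mul, h2, ← two_smul ℂ, smul_smul]
    norm_num
  · simp [hs]

lemma sTs_cle {s T : Matrix ι ι A} (hs : sᴴ = s) (h : (s * T * s)ᴴ = s * T * s) :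
    CLE (s * T * s) (s * s) := by
  obtain ⟨C, hC, h'⟩ := sTs_le hs h
  exact cle_of_mle_smul hC h'

lemma hTh_le {h T : Matrix ι ι A} (hh : MatPos h) (h' : (h * T * h)ᴴ = h * T * h) :
    ∃ C : ℝ, 0 ≤ C ∧ MLE (h * T * h) ((C : ℂ) • h) := by
  obtain ⟨s, hs, rfl⟩ := mat_sqrt hh
  have e : s * s * T * (s * s) = s * (s * T * s) * s := by simp only [Matrix.mul_assoc]
  rw [e] at h' ⊢
  exact sTs_le hs.herm h'

lemma hTh_cle {h T : Matrix ι ι A} (hh : MatPos h) (h' : (h * T * h)ᴴ = h * T * h) :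
    CLE (h * T * h) h := by
  obtain ⟨C, hC, h'⟩ := hTh_le hh h'
  exact cle_of_mle_smul hC h'

/-- no minimal positive elements -/
def NonMin (A : Type) [CStarAlgebra A] : Prop := ∀ (m : ℕ) (h : Matrix (Fin m) (Fin m) A), MatPos h → h ≠ 0 →
  ∃ T1 T2, MatPos (h * T1 * h) ∧ h * T1 * h ≠ 0 ∧ MatPos (h * T2 * h) ∧ h * T2 * h ≠ 0 ∧
    (h * T1 * h) * (h * T2 * h) = 0

lemma lemmaD (hs : IsSimpleCStarAlgebra A) (hN : NonMin A) {m : ℕ} (M : ℕ) :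
    ∀ h : Matrix (Fin m) (Fin m) A, MatPos h → h ≠ 0 →
      ∃ f : Matrix (Fin m) (Fin m) A, MatPos f ∧ f ≠ 0 ∧ CLE (rep (Fin M) f) h := by
  induction M with
  | zero =>
    intro h hh h0
    refine ⟨h, hh, h0, fun ε _ => ⟨0, 0, ?_⟩⟩
    ext i; exact i.2.elim0
  | succ M ih =>
    intro h hh h0
    obtain ⟨T1, T2, p1, n1, p2, n2, hor⟩ := hN m h hh h0
    obtain ⟨f, hf, hf0, hfM⟩ := ih _ p1 n1
    set h2 := h * T2 * h with hh2
    obtain ⟨x, hx⟩ := prime_mat hs hf0 n2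
    have e1 : (f * x * h2) * (f * x * h2)ᴴ = f * (x * h2 * h2 * xᴴ) * f := by
      simp only [Matrix.conjTranspose_mul, hf.herm, p2.herm, Matrix.mul_assoc]
    have e2 : (f * x * h2)ᴴ * (f * x * h2) = h2 * (xᴴ * f * f * x) * h2 := by
      simp only [Matrix.conjTranspose_mul, hf.herm, p2.herm, Matrix.mul_assoc]
    have pe := mat_gram' (f * x * h2)
    have q1 : CLE ((f * x * h2) * (f * x * h2)ᴴ) f := by
      rw [e1]; exact hTh_cle hf (by rw [← e1]; exact pe.herm)
    have q2 : CLE ((f * x * h2) * (f * x * h2)ᴴ) h2 := by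
      have := cle_gram_swap (f * x * h2)ᴴ
      rw [Matrix.conjTranspose_conjTranspose] at this
      refine this.trans ?_
      rw [e2]; exact hTh_cle p2 (by rw [← e2]; exact (mat_gram _).herm)
    refine ⟨(f * x * h2) * (f * x * h2)ᴴ, pe, fun h => hx (gram_zero' h), ?_⟩
    refine (rep_cle_dsum M _).trans ((dsum_mono ((rep_mono q1).trans hfM) q2).trans
      ((dsum_cle_add p1 p2 hor).trans ?_))
    have e3 : h * T1 * h + h2 = h * (T1 + T2) * h := by
      rw [hh2, Matrix.mul_add, Matrix.add_mul]
    have e4 := (mat_add p1 p2).herm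
    rw [e3] at e4 ⊢
    exact hTh_cle hh e4

lemma split (hs : IsSimpleCStarAlgebra A) (hN : NonMin A) {m : ℕ} (M : ℕ)
    {b : Matrix (Fin m) (Fin m) A} (hb : MatPos b) (hb0 : b ≠ 0) :
    ∃ b' e : Matrix (Fin m) (Fin m) A, MatPos b' ∧ MatPos e ∧ e ≠ 0 ∧ CLE (dsum b' e) b ∧
      CLE (rep (Fin M) b) (rep (Fin (M + 1)) b') := by
  obtain ⟨T1, T2, p1, n1, p2, n2, hor⟩ := hN m b hb hb0
  obtain ⟨f, hf, hf0, hfM⟩ := lemmaD hs hN M _ p2 n2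
  obtain ⟨x, hx⟩ := prime_mat hs n1 hf0
  set h1 := b * T1 * b with hh1
  set h2 := b * T2 * b with hh2
  set y := (h1 * x * f) * (h1 * x * f)ᴴ with hy
  have py : MatPos y := mat_gram' _
  have y0 : y ≠ 0 := fun h => hx (gram_zero' h)
  have e1 : y = h1 * (x * f * f * xᴴ) * h1 := by
    simp only [hy, Matrix.conjTranspose_mul, hf.herm, p1.herm, Matrix.mul_assoc]
  have e2 : (h1 * x * f)ᴴ * (h1 * x * f) = f * (xᴴ * h1 * h1 * x) * f := by
    simp only [Matrix.conjTranspose_mul, hf.herm, p1.herm, Matrix.mul_assoc]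
  have yf : CLE y f := by
    have := cle_gram_swap (h1 * x * f)ᴴ
    rw [Matrix.conjTranspose_conjTranspose] at this
    refine this.trans ?_
    rw [e2]; exact hTh_cle hf (by rw [← e2]; exact (mat_gram _).herm)
  obtain ⟨r, z, e, hr, hyr, he, pe, e0, hre⟩ := mat_cut py y0
  set R := r * r * r * r with hR
  have hRs : Rᴴ = R := by simp [hR, hr, Matrix.mul_assoc]
  set g := y * R * y with hg
  have hgs : gᴴ = g := by rw [hg]; simp [hRs, py.herm, Matrix.mul_assoc]
  have hge : g * e = e := by
    have : g = (r * y * r) * (r * y * r) := by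
      rw [hg, hR]
      calc y * (r * r * r * r) * y = (y * r) * r * r * (r * y) := by simp only [Matrix.mul_assoc]
        _ = (r * y) * r * r * (y * r) := by rw [hyr]
        _ = _ := by simp only [Matrix.mul_assoc]
    rw [this, Matrix.mul_assoc, hre, hre]
  have hgh : g * h2 = 0 := by
    have : y * h2 = 0 := by rw [e1, Matrix.mul_assoc, hor, Matrix.mul_zero]
    rw [hg, Matrix.mul_assoc, this, Matrix.mul_zero]
  have hhg : h2 * g = 0 := by
    have := congrArg Matrix.conjTranspose hgh
    simpa [hgs, p2.herm] using this
  obtain ⟨s, hs', hbs⟩ := mat_sqrt hb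
  have h1gs : (1 - g)ᴴ = 1 - g := by simp [hgs]
  set b' := (1 - g) * b * (1 - g) with hb'
  have pb' : MatPos b' := by have := hb.conj (1 - g); rwa [h1gs] at this
  -- claim 1
  have c1 : CLE b (dsum b' y) := by
    have k1 : MLE b (((2 : ℝ) : ℂ) • ((s * (1 - g)) * (s * (1 - g))ᴴ + (s * g) * (s * g)ᴴ)) := by
      have := mat_gram' (s * (1 - g) - s * g)
      unfold MLE
      convert this using 1
      rw [hbs]
      simp only [Matrix.conjTranspose_sub, Matrix.conjTranspose_mul, hs'.herm, h1gs, hgs]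
      push_cast
      rw [two_smul]
      noncomm_ring
    refine (cle_of_mle_smul (by norm_num) k1).trans ((cle_add_dsum _ _).trans (dsum_mono ?_ ?_))
    · have := cle_gram_swap (s * (1 - g))ᴴ
      rw [Matrix.conjTranspose_conjTranspose] at this
      convert this using 1
      simp only [Matrix.conjTranspose_mul, hs'.herm, h1gs, hb', hbs, Matrix.mul_assoc]
    · have k2 : (s * g) * (s * g)ᴴ = (s * y * R) * (y * 1 * y) * (s * y * R)ᴴ := by
        simp only [Matrix.conjTranspose_mul, hs'.herm, hg, hRs, py.herm, Matrix.mul_assoc, Matrix.one_mul]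
      rw [k2]
      refine (cle_conj _ _).trans (hTh_cle py ?_)
      simp [py.herm]
  have c2 : CLE h2 b' := by
    obtain ⟨C, hC, hle⟩ := hTh_le hb p2.herm
    have := hle.conj (1 - g)
    rw [h1gs] at this
    refine cle_of_mle_smul hC ((mle_of_eq ?_).trans (this.trans (mle_of_eq ?_)))
    · change h2 = (1 - g) * h2 * (1 - g)
      simp [Matrix.sub_mul, Matrix.mul_sub, hgh, hhg]
    · rw [hb', Matrix.mul_smul, Matrix.smul_mul]
  refine ⟨b', e, pb', pe, e0, ?_, ?_⟩
  · have k3 : b' * e = 0 := by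
      rw [hb', Matrix.mul_assoc, Matrix.sub_mul 1 g e, hge, Matrix.one_mul, sub_self, Matrix.mul_zero]
    refine (dsum_cle_add pb' pe k3).trans ?_
    set Y := s * T1 * b * (x * f * f * xᴴ) * b * T1 * s with hY
    have yY : y = s * Y * s := by
      rw [e1, hY, hh1, hbs]; simp only [Matrix.mul_assoc]
    set G := Y * s * R * s * Y with hG
    have gG : g = s * G * s := by
      rw [hg, yY, hG]; simp only [Matrix.mul_assoc]
    have k4 : b' + e = s * (1 - G * s * s - s * s * G + G * s * s * s * s * G + Y * s * z * s * Y) * s := by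
      rw [hb', he, gG, yY, hbs]
      noncomm_ring
    have k5 := (mat_add pb' pe).herm
    rw [k4] at k5 ⊢
    rw [hbs]
    exact sTs_cle hs'.herm k5
  · exact (rep_mono c1).trans ((rep_dsum_cle _ _).trans
      ((dsum_mono (CLE.refl _) ((rep_mono yf).trans (hfM.trans c2))).trans (dsum_rep_cle M b')))

lemma diag_cle_rep {n m : ℕ} (f : Matrix (Fin m) (Fin m) A) (i : Fin m) :
    CLE (Matrix.diagonal fun _ : Fin n => f i i) (rep (Fin n) f) := by
  have := cle_sub (rep (Fin n) f) (fun j : Fin n => (i, j))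
  convert this using 1
  ext j j'
  simp [rep_apply, Matrix.diagonal_apply]

theorem nonmin_case {P : BundledCStarAlgebra → Prop} {β : ℝ}
    (hP : ∀ B : BundledCStarAlgebra, P B → BetaComparison B.carrier β)
    (hs : IsSimpleCStarAlgebra A) (hA : AsympTraciallyIn P A) (hN : NonMin A) :
    BetaComparison A β := by
  intro n m k l hk hl hkl a b ha hb h
  have h' : CLE (rep (Fin k) a) (rep (Fin l) b) := CLE.ofMat (rep_pos ha) (rep_pos hb) h
  apply CLE.toMat ha hb
  by_cases hb0 : b = 0
  · have h1 : CLE a (rep (Fin k) a) := by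
      have := cle_sub (rep (Fin k) a) (fun i : Fin n => (i, (⟨0, hk⟩ : Fin k)))
      convert this using 1
      ext i j; simp [rep_apply]
    refine h1.trans (h'.trans ?_)
    have := cle_conj b (0 : Matrix (Fin m × Fin l) (Fin m) A)
    convert this using 1
    ext p q; simp [rep_apply, hb0]
  · obtain ⟨M, hM⟩ : ∃ M : ℕ, β * l / (k - β * l) < M := exists_nat_gt _
    have hpos : 0 < (k : ℝ) - β * l := by linarith
    rw [div_lt_iff₀ hpos] at hM
    obtain ⟨b', e, pb', pe, e0, hbe, hrep⟩ := split hs hN (M + 1) hb hb0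
    obtain ⟨f, pf, f0, hf⟩ := lemmaD hs hN n e pe e0
    obtain ⟨i, hi⟩ := pos_diag pf f0
    have hML : CLE (rep (Fin (k * (M + 1))) a) (rep (Fin (l * (M + 2))) b') := by
      refine (rep_rep_le finProdFinEquiv.symm a).trans ((rep_mono h').trans ((rep_comm_cle _).trans
        ((rep_mono hrep).trans ((rep_comm_cle _).trans (rep_rep_ge finProdFinEquiv.symm b')))))
    have hk' : 1 ≤ k * (M + 1) := Nat.mul_pos hk (by omega)
    have hl' : 1 ≤ l * (M + 2) := Nat.mul_pos hl (by omega)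
    have := main_lemma hP hA hk' hl' (by push_cast; nlinarith) ha pb' hML
      (pos_diag_elem pf i) hi
    exact this.trans ((dsum_mono (CLE.refl _) ((diag_cle_rep f i).trans hf)).trans hbe)
end prime
end BC


namespace BC
section mincase
variable {A : Type} [CStarAlgebra A]
variable {ι κ μ : Type} [Fintype ι] [Fintype κ] [Fintype μ]
  [DecidableEq ι] [DecidableEq κ] [DecidableEq μ]

lemma cube_zero {x : Matrix ι ι A} (hx : xᴴ = x) (h : x * x * x = 0) : x = 0 := by
  have h1 : (x * x)ᴴ * (x * x) = 0 := by
    rw [Matrix.conjTranspose_mul, hx]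
    calc x * x * (x * x) = x * x * x * x := by simp only [Matrix.mul_assoc]
      _ = 0 := by rw [h, Matrix.zero_mul]
  have h2 := gram_zero h1
  exact gram_zero (by rw [hx]; exact h2)

/-- minimality -/
lemma min_herm {h : Matrix ι ι A} (hh : MatPos h)
    (hmin : ¬ ∃ T1 T2, MatPos (h * T1 * h) ∧ h * T1 * h ≠ 0 ∧ MatPos (h * T2 * h) ∧ h * T2 * h ≠ 0 ∧
    (h * T1 * h) * (h * T2 * h) = 0) {z : Matrix ι ι A} (hz : zᴴ = z) :
    ∃ t : ℝ, h * z * h = (t : ℂ) • (h * h) := by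
  obtain ⟨C1, hC1, b1⟩ := mle_bound hz
  obtain ⟨C2, hC2, b2⟩ := mle_bound (x := -z) (by simp [hz])
  have hs := hh.herm
  have pq : MatPos (h * h) := by have := mat_gram h; rwa [hs] at this
  have mono : ∀ {r s : ℝ}, r ≤ s → MLE ((r : ℂ) • (h * h)) ((s : ℂ) • (h * h)) := by
    intro r s hrs
    unfold MLE
    rw [← sub_smul, ← Complex.ofReal_sub]
    exact pq.smul (by linarith)
  have d1 := b1.conj h
  have d2 := b2.conj h
  rw [hs, Matrix.mul_smul, Matrix.mul_one, Matrix.smul_mul] at d1 d2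
  refine mat_scalar (C := C1 + C2) pq (d1.trans (mono (by linarith))) ?_ ?_
  · have := d2.trans (mono (show C2 ≤ C1 + C2 by linarith))
    unfold MLE at this
    convert this using 1
    rw [Matrix.mul_neg, Matrix.neg_mul]; abel
  · intro t
    set y := z - (t : ℂ) • (1 : Matrix ι ι A) with hy
    have hys : yᴴ = y := by rw [hy]; simp [Matrix.conjTranspose_smul, hz]
    have hxy : h * z * h - (t : ℂ) • (h * h) = h * y * h := by
      rw [hy, Matrix.mul_sub, Matrix.sub_mul, Matrix.mul_smul, Matrix.mul_one, Matrix.smul_mul]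
    obtain ⟨p, q, hp, hq, hx, hpq, hqp⟩ := mat_pn (x := h * y * h) (by
      simp [hs, hys, Matrix.mul_assoc])
    have ep : h * (y * h * p * h * y) * h = p * p * p := by
      have : h * (y * h * p * h * y) * h = (h * y * h) * p * (h * y * h) := by
        simp only [Matrix.mul_assoc]
      rw [this, hx]
      simp [Matrix.sub_mul, Matrix.mul_sub, Matrix.mul_assoc, hpq, hqp]
    have eq : h * (y * h * q * h * y) * h = q * q * q := by
      have : h * (y * h * q * h * y) * h = (h * y * h) * q * (h * y * h) := by
        simp only [Matrix.mul_assoc]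
      rw [this, hx]
      simp [Matrix.sub_mul, Matrix.mul_sub, Matrix.mul_assoc, hpq, hqp]
    by_cases p0 : p * p * p = 0
    · right
      have := cube_zero hp.herm p0
      rw [← neg_sub, hxy, hx, this]; simpa using hq
    by_cases q0 : q * q * q = 0
    · left
      have := cube_zero hq.herm q0
      rw [hxy, hx, this]; simpa using hp
    exfalso
    apply hmin
    refine ⟨y * h * p * h * y, y * h * q * h * y, ?_⟩
    rw [ep, eq]
    refine ⟨?_, p0, ?_, q0, ?_⟩
    · have := hp.conj p; rwa [hp.herm] at this
    · have := hq.conj q; rwa [hq.herm] at this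
    · simp only [Matrix.mul_assoc]
      rw [← Matrix.mul_assoc p q, hpq]; simp

lemma min_all {h : Matrix ι ι A} (hh : MatPos h)
    (hmin : ¬ ∃ T1 T2, MatPos (h * T1 * h) ∧ h * T1 * h ≠ 0 ∧ MatPos (h * T2 * h) ∧ h * T2 * h ≠ 0 ∧
    (h * T1 * h) * (h * T2 * h) = 0) (z : Matrix ι ι A) :
    ∃ t : ℂ, h * z * h = t • (h * h) := by
  obtain ⟨t1, h1⟩ := min_herm hh hmin (z := ((1 / 2 : ℝ) : ℂ) • (z + zᴴ)) (by
    simp [Matrix.conjTranspose_smul, add_comm])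
  obtain ⟨t2, h2⟩ := min_herm hh hmin (z := (-(Complex.I / 2)) • (z - zᴴ)) (by
    rw [Matrix.conjTranspose_smul, Matrix.conjTranspose_sub, Matrix.conjTranspose_conjTranspose,
      ← neg_sub z, smul_neg, ← neg_smul]
    congr 1
    simp
    ring)
  refine ⟨t1 + Complex.I * t2, ?_⟩
  have e : z = ((1 / 2 : ℝ) : ℂ) • (z + zᴴ) + Complex.I • ((-(Complex.I / 2)) • (z - zᴴ)) := by
    have hI : Complex.I * (-(Complex.I / 2)) = ((1 / 2 : ℝ) : ℂ) := by
      have := Complex.I_mul_I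
      push_cast
      linear_combination (-1 / 2 : ℂ) * this
    rw [smul_smul, hI, smul_add, smul_sub]
    have : z = ((1 / 2 : ℝ) : ℂ) • z + ((1 / 2 : ℝ) : ℂ) • z := by
      rw [← add_smul, ← Complex.ofReal_add]; norm_num
    conv_lhs => rw [this]
    abel
  rw [e, Matrix.mul_add, Matrix.add_mul, h1, Matrix.mul_smul h Complex.I, Matrix.smul_mul, h2, smul_smul, ← add_smul]

lemma exists_min_proj (hN : ¬ NonMin A) : ∃ p : A, p ≠ 0 ∧ p * p = p ∧ star p = p ∧
    ∀ x, ∃ c : ℂ, p * x * p = c • p := by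
  unfold NonMin at hN
  push Not at hN
  obtain ⟨m, h, hh, h0, hmin⟩ := hN
  have hs := hh.herm
  have H := min_all hh (by
    rintro ⟨T1, T2, a1, a2, a3, a4, a5⟩
    exact hmin T1 T2 a1 a2 a3 a4 a5)
  set q := h * h with hq
  have pq : MatPos q := by have := mat_gram h; rwa [hs] at this
  have q0 : q ≠ 0 := fun h' => h0 (gram_zero (by rw [hs]; exact h'))
  have Hq : ∀ z, ∃ t : ℂ, q * z * q = t • q := by
    intro z
    obtain ⟨t, ht⟩ := H z
    obtain ⟨t', ht'⟩ := H q
    refine ⟨t * t', ?_⟩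
    calc q * z * q = h * (h * z * h) * h := by rw [hq]; simp only [Matrix.mul_assoc]
      _ = t • (h * q * h) := by rw [ht]; simp
      _ = _ := by rw [ht', smul_smul]
  obtain ⟨i, hi⟩ := pos_diag pq q0
  obtain ⟨d, hd⟩ := pos_diag_elem pq i
  set u := q i i with hu
  have us : star u = u := by rw [hd]; simp
  have Hu : ∀ x, ∃ t : ℂ, u * x * u = t • u := by
    intro x
    obtain ⟨t, ht⟩ := Hq (Matrix.single i i x)
    refine ⟨t, ?_⟩
    have := congrFun (congrFun ht i) i
    simpa [Matrix.mul_apply, Matrix.single_apply, Finset.sum_ite_eq, ite_and] using this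
  obtain ⟨t, ht⟩ := Hu 1
  rw [mul_one] at ht
  have t0 : t ≠ 0 := by
    rintro rfl
    rw [zero_smul] at ht
    apply hi
    rw [← CStarRing.star_mul_self_eq_zero_iff, us]; exact ht
  have ts : star t = t := by
    have h1 := congrArg star ht
    rw [star_mul, us, ht, star_smul, us] at h1
    have h2 : (t - star t) • u = 0 := by rw [sub_smul, ← h1, sub_self]
    rcases smul_eq_zero.1 h2 with h3 | h3
    · exact (sub_eq_zero.1 h3).symm
    · exact absurd h3 hi
  refine ⟨t⁻¹ • u, ?_, ?_, ?_, ?_⟩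
  · exact smul_ne_zero (inv_ne_zero t0) hi
  · rw [smul_mul_smul_comm, ht, smul_smul]; congr 1; field_simp
  · rw [star_smul, us, star_inv₀, ts]
  · intro x
    obtain ⟨c, hc⟩ := Hu x
    refine ⟨t⁻¹ * c, ?_⟩
    rw [smul_mul_assoc, smul_mul_smul_comm, hc, smul_smul, smul_smul]
    congr 1; ring

/-- finite sums -/
def SumForm (p x : A) : Prop := ∃ (K : Type) (_ : Fintype K) (_ : DecidableEq K) (u w : K → A),
  x = ∑ r, u r * p * w r

lemma SumForm.add {p x y : A} (hx : SumForm p x) (hy : SumForm p y) : SumForm p (x + y) := by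
  obtain ⟨K, _, _, u, w, rfl⟩ := hx
  obtain ⟨K', _, _, u', w', rfl⟩ := hy
  exact ⟨K ⊕ K', inferInstance, inferInstance, Sum.elim u u', Sum.elim w w', by simp [Fintype.sum_sum_type]⟩

lemma SumForm.mul_left {p x : A} (hx : SumForm p x) (y : A) : SumForm p (y * x) := by
  obtain ⟨K, _, _, u, w, rfl⟩ := hx
  exact ⟨K, inferInstance, inferInstance, fun r => y * u r, w, by simp [Finset.mul_sum, mul_assoc]⟩

lemma SumForm.mul_right {p x : A} (hx : SumForm p x) (y : A) : SumForm p (x * y) := by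
  obtain ⟨K, _, _, u, w, rfl⟩ := hx
  exact ⟨K, inferInstance, inferInstance, u, fun r => w r * y, by simp [Finset.sum_mul, mul_assoc]⟩

lemma sumForm_one (hs : IsSimpleCStarAlgebra A) {p : A} (hp : p ≠ 0) : SumForm p 1 := by
  set S : Set A := {x | SumForm p x} with hS
  have z0 : (0 : A) ∈ S := ⟨Empty, inferInstance, inferInstance, Empty.elim, Empty.elim, by simp⟩
  let I : TwoSidedIdeal A := TwoSidedIdeal.mk' (closure S)
    (subset_closure z0)
    (fun {x y} hx hy => map_mem_closure₂ continuous_add hx hy fun a ha b hb => SumForm.add ha hb)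
    (fun {x} hx => map_mem_closure continuous_neg hx fun a ha => by
      have := SumForm.mul_left ha (-1)
      rw [neg_one_mul] at this
      exact this)
    (fun {x y} hy => map_mem_closure (f := fun t => x * t) (continuous_const_mul x) hy fun a ha => SumForm.mul_left ha x)
    (fun {x y} hx => map_mem_closure (f := fun t => t * y) (continuous_mul_const y) hx fun a ha => SumForm.mul_right ha y)
  have hI : ∀ x, x ∈ I ↔ x ∈ closure S := fun x => TwoSidedIdeal.mem_mk' _ _ _ _ _ _ x
  have hcl : IsClosed (I : Set A) := by
    have : (I : Set A) = closure S := by ext x; exact hI x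
    rw [this]; exact isClosed_closure
  have hpS : p ∈ S := ⟨Unit, inferInstance, inferInstance, fun _ => 1, fun _ => 1, by simp⟩
  have hone : (1 : A) ∈ closure S := by
    rcases hs I hcl with h | h
    · have : p ∈ I := (hI p).2 (subset_closure hpS)
      rw [h] at this
      exact absurd (by simpa using this) hp
    · exact (hI 1).1 (by rw [h]; trivial)
  obtain ⟨s, hsS, hd⟩ := Metric.mem_closure_iff.1 hone 1 one_pos
  rw [dist_eq_norm] at hd
  have hu : IsUnit s := by
    have := (Units.oneSub (1 - s) hd).isUnit
    simpa using this
  obtain ⟨v, hv⟩ := hu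
  have := SumForm.mul_left hsS (↑v⁻¹ : A)
  rwa [← hv, Units.inv_mul] at this

/-- lift of scalar matrices -/
def L (p : A) (M : Matrix ι κ ℂ) : Matrix ι κ A := M.map fun c => c • p

lemma L_mul {p : A} (hp : p * p = p) (M : Matrix ι κ ℂ) (N : Matrix κ μ ℂ) : L p (M * N) = L p M * L p N := by
  ext i j
  simp only [L, Matrix.mul_apply, Matrix.map_apply, Finset.sum_smul]
  exact Finset.sum_congr rfl fun k _ => by rw [smul_mul_smul_comm, hp]

lemma L_star {p : A} (hp : star p = p) (M : Matrix ι κ ℂ) : L p Mᴴ = (L p M)ᴴ := by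
  ext i j
  simp [L, star_smul, hp]

lemma L_sub (p : A) (M N : Matrix ι κ ℂ) : L p (M - N) = L p M - L p N := by
  ext i j; simp [L, sub_smul]

lemma L_smul (p : A) (c : ℂ) (M : Matrix ι κ ℂ) : L p (c • M) = c • L p M := by
  ext i j; simp [L, mul_smul]

lemma L_inj {p : A} (hp : p ≠ 0) {M N : Matrix ι κ ℂ} (h : L p M = L p N) : M = N := by
  ext i j
  have := congrFun (congrFun h i) j
  exact smul_left_injective ℂ hp this

lemma L_exists {p : A} (H : ∀ x, ∃ c : ℂ, p * x * p = c • p) (M : Matrix ι κ A) :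
    ∃ N : Matrix ι κ ℂ, L p (1 : Matrix ι ι ℂ) * M * L p (1 : Matrix κ κ ℂ) = L p N := by
  choose c hc using H
  refine ⟨Matrix.of fun i j => c (M i j), ?_⟩
  ext i j
  simp [L, Matrix.mul_apply, Matrix.one_apply, ite_smul, hc]

lemma L_rep (p : A) {J : Type} [Fintype J] [DecidableEq J] :
    rep J (L p (1 : Matrix ι ι ℂ)) = L p (1 : Matrix (ι × J) (ι × J) ℂ) := by
  ext ⟨i, j⟩ ⟨i', j'⟩
  by_cases h : i = i' <;> by_cases h' : j = j' <;> simp [rep_apply, L, h, h', Matrix.one_apply]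

lemma L_card_le {p : A} (p0 : p ≠ 0) (hp : p * p = p) (hs : star p = p)
    (H : ∀ x, ∃ c : ℂ, p * x * p = c • p)
    (h : CLE (L p (1 : Matrix ι ι ℂ)) (L p (1 : Matrix κ κ ℂ))) : Fintype.card ι ≤ Fintype.card κ := by
  by_contra hlt
  push Not at hlt
  obtain ⟨v, hv⟩ := h (1 / 2) (by norm_num)
  obtain ⟨W, hW⟩ := L_exists H v
  have h1 : MLE (L p (1 : Matrix ι ι ℂ)) (L p (W * Wᴴ) + ((1 / 2 : ℝ) : ℂ) • L p (1 : Matrix ι ι ℂ)) := by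
    have h2 := hv.conj (L p (1 : Matrix ι ι ℂ))
    have e1 : ∀ {σ : Type} [Fintype σ] [DecidableEq σ],
        L p (1 : Matrix σ σ ℂ) * L p (1 : Matrix σ σ ℂ) = L p 1 := by
      intro σ _ _; rw [← L_mul hp, Matrix.mul_one]
    have e2 : ∀ {σ : Type} [Fintype σ] [DecidableEq σ],
        (L p (1 : Matrix σ σ ℂ))ᴴ = L p 1 := by
      intro σ _ _; rw [← L_star hs, Matrix.conjTranspose_one]
    convert h2 using 1
    · rw [e2, e1, e1]
    · rw [L_mul hp, L_star hs, ← hW, Matrix.mul_add, Matrix.add_mul]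
      congr 1
      · simp only [Matrix.conjTranspose_mul, e2]
        simp only [Matrix.mul_assoc]
        rw [← Matrix.mul_assoc (L p (1 : Matrix κ κ ℂ)) (L p (1 : Matrix κ κ ℂ)), e1]
      · rw [Matrix.mul_smul, Matrix.smul_mul, Matrix.mul_one, e2, e1]
  obtain ⟨x, hx, hx0⟩ : ∃ x : ι → ℂ, Wᴴ *ᵥ x = 0 ∧ x ≠ 0 := by
    have := LinearMap.ker_ne_bot_of_finrank_lt (f := Matrix.mulVecLin Wᴴ) (by simpa using hlt)
    obtain ⟨x, hx, hx0⟩ := (Submodule.ne_bot_iff _).1 this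
    exact ⟨x, by simpa using hx, hx0⟩
  set X : Matrix ι Unit ℂ := Matrix.of fun i _ => x i with hX
  have hWX : Wᴴ * X = 0 := by
    ext i j
    exact congrFun hx i
  have h3 := h1.conj (L p Xᴴ)
  have e3 : L p Xᴴ * (L p (W * Wᴴ) + ((1 / 2 : ℝ) : ℂ) • L p (1 : Matrix ι ι ℂ)) * (L p Xᴴ)ᴴ =
      ((1 / 2 : ℝ) : ℂ) • (L p (Xᴴ * X)) := by
    rw [← L_star hs, Matrix.conjTranspose_conjTranspose, Matrix.mul_add, Matrix.add_mul,
      ← L_mul hp, ← L_mul hp, Matrix.mul_smul, Matrix.smul_mul, ← L_mul hp, ← L_mul hp, Matrix.mul_one]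
    have : Xᴴ * (W * Wᴴ) * X = 0 := by
      rw [Matrix.mul_assoc, Matrix.mul_assoc, hWX]; simp
    rw [this]
    have : L p (0 : Matrix Unit Unit ℂ) = 0 := by ext; simp [L]
    rw [this, zero_add]
  rw [e3, ← L_star hs, Matrix.conjTranspose_conjTranspose, ← L_mul hp, ← L_mul hp, Matrix.mul_one] at h3
  have h4 : MatPos (L p (Xᴴ * X)) := by rw [L_mul hp, L_star hs]; exact mat_gram _
  have h5 : MatPos (-L p (Xᴴ * X)) := by
    have := MatPos.smul h3 (r := 2) (by norm_num)
    convert this using 1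
    rw [smul_sub, smul_smul]
    push_cast
    rw [two_smul]; norm_num
  have h6 : Xᴴ * X = 0 := L_inj p0 (by
    rw [mat_antisymm h4 h5]; ext; simp [L])
  have h7 : X = 0 := gram_zero (A := ℂ) h6
  apply hx0
  ext i
  exact congrFun (congrFun h7 i) ()

lemma L_diagonalize {p : A} (p0 : p ≠ 0) (hp : p * p = p) (hs : star p = p)
    {C : Matrix ι ι ℂ} (hC : MatPos (L p C)) :
    ∃ (σ : Type) (_ : Fintype σ) (_ : DecidableEq σ),
      CLE (L p C) (L p (1 : Matrix σ σ ℂ)) ∧ CLE (L p (1 : Matrix σ σ ℂ)) (L p C) := by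
  have hCs : C.IsHermitian := by
    apply L_inj p0
    rw [L_star hs]; exact hC.herm
  set U : Matrix ι ι ℂ := hCs.eigenvectorUnitary.1 with hU
  set ev : ι → ℂ := fun i => (hCs.eigenvalues i : ℂ) with hev
  have evs : ∀ i, star (ev i) = ev i := fun i => by simp [hev]
  have hsp : C = U * Matrix.diagonal ev * Uᴴ := by
    have := hCs.spectral_theorem
    rw [Unitary.conjStarAlgAut_apply] at this
    exact this
  have hUU : Uᴴ * U = 1 := Unitary.coe_star_mul_self hCs.eigenvectorUnitary
  have hCC : C * C = U * (Matrix.diagonal ev * Matrix.diagonal ev) * Uᴴ := by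
    rw [hsp]
    calc U * diagonal ev * Uᴴ * (U * diagonal ev * Uᴴ) = U * diagonal ev * (Uᴴ * U) * (diagonal ev * Uᴴ) := by
          simp only [Matrix.mul_assoc]
      _ = _ := by rw [hUU]; simp only [Matrix.mul_assoc, Matrix.one_mul]
  classical
  set σ := {i // ev i ≠ 0} with hσ
  set Z : Matrix ι σ ℂ := Matrix.of fun i j => if i = j.1 then ev i else 0 with hZ
  set V : Matrix σ ι ℂ := Matrix.of fun j i => if i = j.1 then (ev i)⁻¹ else 0 with hV
  have hZZ : Matrix.diagonal ev * Matrix.diagonal ev = Z * (1 : Matrix σ σ ℂ) * Zᴴ := by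
    rw [Matrix.mul_one]
    ext i j
    rw [Matrix.diagonal_mul_diagonal, Matrix.mul_apply, Matrix.diagonal_apply]
    simp only [hZ, Matrix.conjTranspose_apply, Matrix.of_apply]
    by_cases hi : ev i = 0
    · rw [Finset.sum_eq_zero]
      · simp [hi]
      · intro k _; simp [hi]
    · rw [Finset.sum_eq_single (⟨i, hi⟩ : σ)]
      · by_cases hij : i = j
        · subst hij; simp [evs]
        · simp [hij, Ne.symm hij]
      · intro k _ hk
        have : i ≠ k.1 := fun h => hk (Subtype.ext h.symm)
        simp [this]
      · simp
  have hVV : V * (Matrix.diagonal ev * Matrix.diagonal ev) * Vᴴ = 1 := by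
    ext i j
    rw [Matrix.diagonal_mul_diagonal, Matrix.mul_apply, Matrix.one_apply]
    simp only [Matrix.mul_diagonal, hV, Matrix.conjTranspose_apply, Matrix.of_apply]
    rw [Finset.sum_eq_single i.1]
    · by_cases hij : i = j
      · subst hij
        have hi := i.2
        simp only [if_true, star_inv₀, evs]
        field_simp
      · have : i.1 ≠ j.1 := fun h => hij (Subtype.ext h)
        simp [hij, this]
    · intro k _ hk
      simp [hk]
    · simp
  refine ⟨σ, inferInstance, inferInstance, ?_, ?_⟩
  · refine (cle_sq hC.herm).trans ?_
    rw [← L_mul hp, hCC, hZZ, L_mul hp, L_mul hp, L_star hs]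
    refine (cle_conj _ _).trans ?_
    rw [L_mul hp, L_mul hp, L_star hs]
    exact cle_conj _ _
  · have e : (1 : Matrix σ σ ℂ) = (V * Uᴴ) * (C * C) * (V * Uᴴ)ᴴ := by
      rw [hCC, ← hVV]
      simp only [Matrix.conjTranspose_mul, Matrix.conjTranspose_conjTranspose]
      calc _ = V * (diagonal ev * diagonal ev) * Vᴴ := rfl
        _ = V * (Uᴴ * U) * (diagonal ev * diagonal ev) * (Uᴴ * U) * Vᴴ := by
          rw [hUU]; simp only [Matrix.mul_one]
        _ = _ := by simp only [Matrix.mul_assoc]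
    rw [e, L_mul hp, L_mul hp, L_star hs]
    refine (cle_conj _ _).trans ?_
    have e' : L p (C * C) = L p C * 1 * L p C := by rw [Matrix.mul_one, L_mul hp]
    have e'' : (L p (C * C))ᴴ = L p (C * C) := by rw [L_mul hp, Matrix.conjTranspose_mul, hC.herm]
    rw [e'] at e'' ⊢
    exact hTh_cle hC e''

lemma L_reduce {p : A} (hp : p * p = p) (hs : star p = p)
    (H : ∀ x, ∃ c : ℂ, p * x * p = c • p) (h1 : SumForm p 1) {a : Matrix ι ι A} (ha : MatPos a) :
    ∃ (K : Type) (_ : Fintype K) (_ : DecidableEq K) (C : Matrix K K ℂ),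
      MatPos (L p C) ∧ CLE a (L p C) ∧ CLE (L p C) a := by
  obtain ⟨K, _, _, u, w, h1⟩ := h1
  set X : Matrix ι (ι × K) A := Matrix.of fun i j => if i = j.1 then u j.2 * p else 0 with hX
  set Y : Matrix (ι × K) ι A := Matrix.of fun j i => if i = j.1 then p * w j.2 else 0 with hY
  have hXY : X * Y = 1 := by
    ext i j
    rw [Matrix.mul_apply, Fintype.sum_prod_type]
    simp only [hX, hY, Matrix.of_apply]
    rw [Finset.sum_eq_single i]
    · by_cases hij : j = i
      · subst hij
        simp only [if_true, Matrix.one_apply_eq]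
        rw [h1]
        refine Finset.sum_congr rfl fun r _ => ?_
        rw [mul_assoc, ← mul_assoc p p, hp, mul_assoc]
      · simp [hij, Matrix.one_apply, Ne.symm hij]
    · intro k _ hk
      simp [Ne.symm hk]
    · simp
  have e1 : L p (1 : Matrix (ι × K) (ι × K) ℂ) * Y = Y := by
    ext ⟨j, r⟩ i
    simp only [L, Matrix.mul_apply, hY, Matrix.map_apply, Matrix.of_apply]
    rw [Finset.sum_eq_single (j, r)]
    · by_cases hij : i = j
      · simp [hij, ← mul_assoc, hp]
      · simp [hij]
    · intro k _ hk
      simp [Matrix.one_apply, Ne.symm hk]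
    · simp
  have e2 : (L p (1 : Matrix (ι × K) (ι × K) ℂ))ᴴ = L p 1 := by
    rw [← L_star hs, Matrix.conjTranspose_one]
  obtain ⟨C, hC⟩ := L_exists H (Y * a * Yᴴ)
  have e3 : Y * a * Yᴴ = L p C := by
    rw [← hC]
    have e4 : Yᴴ * L p (1 : Matrix (ι × K) (ι × K) ℂ) = Yᴴ := by
      have := congrArg Matrix.conjTranspose e1
      rwa [Matrix.conjTranspose_mul, e2] at this
    calc Y * a * Yᴴ = (L p (1 : Matrix (ι × K) (ι × K) ℂ) * Y) * a * (Yᴴ * L p (1 : Matrix (ι × K) (ι × K) ℂ)) := by rw [e1, e4]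
      _ = _ := by simp only [Matrix.mul_assoc]
  refine ⟨ι × K, inferInstance, inferInstance, C, ?_, ?_, ?_⟩
  · rw [← e3]; exact ha.conj Y
  · have := cle_conj (L p C) X
    convert this using 1
    rw [← e3]
    calc a = (X * Y) * a * (X * Y)ᴴ := by rw [hXY]; simp
      _ = _ := by simp only [Matrix.conjTranspose_mul, Matrix.mul_assoc]
  · rw [← e3]; exact cle_conj _ _

theorem min_case {β : ℝ} (hβ : 1 ≤ β) (hs : IsSimpleCStarAlgebra A) (hN : ¬ NonMin A) :
    BetaComparison A β := by
  intro n m k l hk hl hkl a b ha hb h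
  have h' : CLE (rep (Fin k) a) (rep (Fin l) b) := CLE.ofMat (rep_pos ha) (rep_pos hb) h
  apply CLE.toMat ha hb
  obtain ⟨p, p0, hp, ps, H⟩ := exists_min_proj hN
  have h1 := sumForm_one hs p0
  obtain ⟨K, _, _, C, hC, aC, Ca⟩ := L_reduce hp ps H h1 ha
  obtain ⟨K', _, _, D, hD, bD, Db⟩ := L_reduce hp ps H h1 hb
  obtain ⟨σ, _, _, Cσ, σC⟩ := L_diagonalize p0 hp ps hC
  obtain ⟨τ, _, _, Dτ, τD⟩ := L_diagonalize p0 hp ps hD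
  have h2 : CLE (rep (Fin k) (L p (1 : Matrix σ σ ℂ))) (rep (Fin l) (L p (1 : Matrix τ τ ℂ))) :=
    (rep_mono (σC.trans Ca)).trans (h'.trans (rep_mono (bD.trans Dτ)))
  rw [L_rep, L_rep] at h2
  have h3 := L_card_le p0 hp ps H h2
  rw [Fintype.card_prod, Fintype.card_prod, Fintype.card_fin, Fintype.card_fin] at h3
  have hlk : l < k := by
    have : (l : ℝ) < k := by
      have : (0 : ℝ) ≤ l := by positivity
      nlinarith
    exact_mod_cast this
  have h4 : Fintype.card σ ≤ Fintype.card τ := by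
    by_contra hc
    push Not at hc
    nlinarith
  obtain ⟨f⟩ := Function.Embedding.nonempty_of_card_le h4
  have h5 : CLE (L p (1 : Matrix σ σ ℂ)) (L p (1 : Matrix τ τ ℂ)) := by
    have := cle_sub (L p (1 : Matrix τ τ ℂ)) f
    convert this using 1
    ext i j
    by_cases hij : i = j <;> simp [L, hij, Matrix.one_apply, f.injective.eq_iff]
  exact (aC.trans Cσ).trans (h5.trans (τD.trans Db))

end mincase

theorem final (P : BundledCStarAlgebra → Prop) (β : ℝ) (hβ : 1 ≤ β)
    (hP : ∀ B : BundledCStarAlgebra, P B → StablyFinite B.carrier ∧ BetaComparison B.carrier β)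
    (A : Type) [CStarAlgebra A]
    (hsimple : IsSimpleCStarAlgebra A)
    (hA : AsympTraciallyIn P A) :
    BetaComparison A β := by
  by_cases hN : NonMin A
  · exact nonmin_case (fun B hB => (hP B hB).2) hsimple hA hN
  · exact min_case hβ hsimple hN
end BC

/-- If `P` is a class of stably finite unital C*-algebras each having `β`-comparison
(in the sense of Kirchberg and Rørdam) for a real number `1 ≤ β < ∞`, then every
simple unital C*-algebra that is asymptotically tracially in `P` has `β`-comparison. -/
theorem betaComparison_of_asympTraciallyIn
    (P : BundledCStarAlgebra → Prop) (β : ℝ) (hβ : 1 ≤ β)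
    (hP : ∀ B : BundledCStarAlgebra, P B → StablyFinite B.carrier ∧ BetaComparison B.carrier β)
    (A : Type) [CStarAlgebra A]
    (hsimple : IsSimpleCStarAlgebra A)
    (hA : AsympTraciallyIn P A) :
    BetaComparison A β := by
  exact BC.final P β hβ hP A hsimple hA
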